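/- arXiv:2407.09465 — 2 statements merged into one kernel-verified Lean document; each statement's English description precedes it below -/
import Mathlib

section
/- Let n ≥ 1 and let γ denote the standard Gaussian measure on ℝⁿ. Let μ and ν be probability measures on ℝⁿ with finite second moments (∫‖x‖² dμ(x) < ∞ and ∫‖x‖² dν(x) < ∞), and assume μ is centered (∫ x dμ(x) = 0). Then the infimum, over all couplings π of μ and ν (probability measures on ℝⁿ × ℝⁿ with first marginal μ and second marginal ν), of ∫ ‖x − y‖² dπ(x,y) is at most 2 D(μ‖γ) + 2 D(ν‖γ), where D denotes relative entropy (Kullback–Leibler divergence). -/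
open MeasureTheory ENNReal

/-- The standard Gaussian measure on `ℝⁿ`, with density
`(2π)^{-n/2} exp(-‖x‖²/2)` w.r.t. Lebesgue measure. -/
noncomputable def stdGaussian (n : ℕ) : Measure (EuclideanSpace ℝ (Fin n)) :=
  (volume : Measure (EuclideanSpace ℝ (Fin n))).withDensity
    (fun x => ENNReal.ofReal ((2 * Real.pi) ^ (-(n : ℝ) / 2) * Real.exp (-‖x‖ ^ 2 / 2)))

/-- The relative entropy (Kullback–Leibler divergence) `D(μ‖γ)`:
`∫ log (dμ/dγ) dμ` when `μ ≪ γ` and the integral is defined, `+∞` otherwise. -/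
noncomputable def relEntropy {E : Type*} [MeasurableSpace E] (μ γ : Measure E) : ℝ≥0∞ :=
  open scoped Classical in
  if μ ≪ γ ∧ Integrable (llr μ γ) μ then ENNReal.ofReal (∫ x, llr μ γ x ∂μ) else ∞

/-- `π` is a coupling of `μ` and `ν` if its marginals are `μ` and `ν`. -/
def IsCoupling {E : Type*} [MeasurableSpace E] (π : Measure (E × E)) (μ ν : Measure E) : Prop :=
  π.map Prod.fst = μ ∧ π.map Prod.snd = ν

section
open ProbabilityTheory Set Filter Topology InformationTheory

theorem continuous_cdf_of_nullSingletonClass (μ : Measure ℝ) [IsProbabilityMeasure μ]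
    [NullSingletonClass μ] : Continuous (cdf μ) := by
  refine continuous_iff_continuousAt.2 fun x => ?_
  have h : (cdf μ).measure {x} = 0 := by rw [measure_cdf]; exact measure_singleton x
  rw [StieltjesFunction.measure_singleton, ENNReal.ofReal_eq_zero, sub_nonpos] at h
  refine continuousAt_iff_continuous_left'_right'.2 ⟨?_, ?_⟩
  · rw [(cdf μ).mono.continuousWithinAt_Iio_iff_leftLim_eq]
    exact le_antisymm ((cdf μ).mono.leftLim_le le_rfl) h
  · exact ((cdf μ).right_continuous x).mono Ioi_subset_Ici_self

theorem gaussianReal_Iic_lt_Iic {s t : ℝ} (h : s < t) :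
    gaussianReal 0 1 (Iic s) < gaussianReal 0 1 (Iic t) := by
  have hpos : 0 < gaussianReal 0 1 (Ioc s t) := by
    rw [pos_iff_ne_zero]
    intro h0
    have := gaussianReal_absolutelyContinuous' 0 one_ne_zero h0
    simp at this
    linarith
  rw [← Iic_union_Ioc_eq_Iic h.le, measure_union ?_ measurableSet_Ioc]
  · exact ENNReal.lt_add_right (measure_ne_top _ _) hpos.ne'
  · exact Iic_disjoint_Ioc le_rfl

theorem gaussianReal_Iic_le_Iic {s t : ℝ} :
    gaussianReal 0 1 (Iic s) ≤ gaussianReal 0 1 (Iic t) ↔ s ≤ t :=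
  (show StrictMono fun s => gaussianReal 0 1 (Iic s) from
    fun _ _ h => gaussianReal_Iic_lt_Iic h).le_iff_le

theorem gaussianReal_Iic_pos (s : ℝ) : 0 < gaussianReal 0 1 (Iic s) :=
  bot_le.trans_lt (gaussianReal_Iic_lt_Iic (sub_one_lt s))

theorem gaussianReal_Iic_lt_one (s : ℝ) : gaussianReal 0 1 (Iic s) < 1 :=
  (gaussianReal_Iic_lt_Iic (lt_add_one s)).trans_le prob_le_one

instance : NullSingletonClass (gaussianReal 0 1) := nullSingletonClass_gaussianReal one_ne_zero

/-- The distribution function of the standard Gaussian, evaluated at a standard Gaussian variable,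
is uniformly distributed. -/
theorem gaussianReal_setOf_Iic_le {p : ℝ≥0∞} (hp : p ≤ 1) :
    gaussianReal 0 1 {g | gaussianReal 0 1 (Iic g) ≤ p} = p := by
  rcases eq_or_ne p 0 with rfl | hp0
  · simp [(gaussianReal_Iic_pos _).ne']
  rcases hp.eq_or_lt with rfl | hp1
  · simp [prob_le_one]
  obtain ⟨t, ht⟩ : p.toReal ∈ range (cdf (gaussianReal 0 1)) := by
    refine mem_range_of_exists_le_of_exists_ge (continuous_cdf_of_nullSingletonClass _) ?_ ?_
    · exact ((tendsto_cdf_atBot (gaussianReal 0 1)).eventually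
        (eventually_le_nhds (ENNReal.toReal_pos hp0 hp1.ne_top))).exists
    · refine ((tendsto_cdf_atTop (gaussianReal 0 1)).eventually
        (eventually_ge_nhds ?_)).exists
      simpa using (ENNReal.toReal_lt_toReal hp1.ne_top one_ne_top).2 hp1
  have ht' : gaussianReal 0 1 (Iic t) = p := by
    rw [← ofReal_cdf, ht, ofReal_toReal hp1.ne_top]
  simp_rw [← ht', gaussianReal_Iic_le_Iic]
  rfl

theorem gaussianReal_setOf_lt_Iic {p : ℝ≥0∞} (hp : p ≤ 1) :
    gaussianReal 0 1 {g | p < gaussianReal 0 1 (Iic g)} = 1 - p := by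
  have hm : MeasurableSet {g | gaussianReal 0 1 (Iic g) ≤ p} := by
    refine measurableSet_le (Monotone.measurable ?_) measurable_const
    exact fun s t h => gaussianReal_Iic_le_Iic.2 h
  have : {g | p < gaussianReal 0 1 (Iic g)} = {g | gaussianReal 0 1 (Iic g) ≤ p}ᶜ := by
    ext; simp
  rw [this, prob_compl_eq_one_sub hm, gaussianReal_setOf_Iic_le hp]

theorem hasDerivAt_gaussianPDFReal (x : ℝ) :
    HasDerivAt (gaussianPDFReal 0 1) (-(x * gaussianPDFReal 0 1 x)) x := by
  unfold gaussianPDFReal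
  have h : HasDerivAt (fun x : ℝ => -(x - 0) ^ 2 / (2 * ((1 : NNReal) : ℝ))) (-x) x := by
    convert! ((((hasDerivAt_id x).sub_const 0).pow 2).neg.div_const (2 * ((1 : NNReal) : ℝ))) using 1
    simp
    ring
  convert! (h.exp.const_mul (√(2 * Real.pi * ((1 : NNReal) : ℝ)))⁻¹) using 1
  ring

theorem tendsto_gaussianPDFReal_atTop : Tendsto (gaussianPDFReal 0 1) atTop (𝓝 0) := by
  have h : Tendsto (fun x : ℝ => -(x - 0) ^ 2 / (2 * ((1 : NNReal) : ℝ))) atTop atBot := by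
    have h2 : Tendsto (fun x : ℝ => x ^ 2 / 2) atTop atTop :=
      (tendsto_pow_atTop two_ne_zero).atTop_div_const two_pos
    refine (tendsto_neg_atTop_atBot.comp h2).congr fun x => ?_
    simp
    ring
  have := (Real.tendsto_exp_atBot.comp h).const_mul (√(2 * Real.pi * ((1 : NNReal) : ℝ)))⁻¹
  rw [mul_zero] at this
  exact this

theorem gaussianPDFReal_neg' (x : ℝ) : gaussianPDFReal 0 1 (-x) = gaussianPDFReal 0 1 x := by
  simp [gaussianPDFReal]

theorem tendsto_gaussianPDFReal_atBot : Tendsto (gaussianPDFReal 0 1) atBot (𝓝 0) :=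
  (tendsto_gaussianPDFReal_atTop.comp tendsto_neg_atBot_atTop).congr gaussianPDFReal_neg'

theorem integrable_id_gaussianReal : Integrable (fun x : ℝ => x) (gaussianReal 0 1) :=
  memLp_one_iff_integrable.1 (memLp_id_gaussianReal' 1 one_ne_top)

theorem integrable_mul_gaussianPDFReal : Integrable (fun x : ℝ => x * gaussianPDFReal 0 1 x) := by
  have := integrable_id_gaussianReal
  rw [gaussianReal_of_var_ne_zero _ one_ne_zero, integrable_withDensity_iff
    (measurable_gaussianPDF _ _) (ae_of_all _ fun _ => gaussianPDF_lt_top)] at this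
  simpa using this

theorem setIntegral_gaussianReal {s : Set ℝ} (hs : MeasurableSet s) (f : ℝ → ℝ) :
    ∫ x in s, f x ∂(gaussianReal 0 1) = ∫ x in s, gaussianPDFReal 0 1 x * f x := by
  rw [gaussianReal_of_var_ne_zero _ one_ne_zero, setIntegral_withDensity_eq_setIntegral_toReal_smul
    (measurable_gaussianPDF _ _) (ae_of_all _ fun _ => gaussianPDF_lt_top) _ hs]
  simp

theorem setIntegral_Ioi_gaussianReal (s : ℝ) :
    ∫ x in Ioi s, x ∂(gaussianReal 0 1) = gaussianPDFReal 0 1 s := by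
  rw [setIntegral_gaussianReal measurableSet_Ioi]
  have := integral_Ioi_of_hasDerivAt_of_tendsto (a := s) (f := fun x => - gaussianPDFReal 0 1 x)
    (f' := fun x => x * gaussianPDFReal 0 1 x) (m := 0)
    (hasDerivAt_gaussianPDFReal s).continuousAt.neg.continuousWithinAt
    (fun x _ => by simpa using! (hasDerivAt_gaussianPDFReal x).neg)
    integrable_mul_gaussianPDFReal.integrableOn (by simpa using! tendsto_gaussianPDFReal_atTop.neg)
  simpa [mul_comm] using this

theorem setIntegral_Iic_gaussianReal (s : ℝ) :
    ∫ x in Iic s, x ∂(gaussianReal 0 1) = -gaussianPDFReal 0 1 s := by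
  rw [setIntegral_gaussianReal measurableSet_Iic]
  have := integral_Iic_of_hasDerivAt_of_tendsto (a := s) (f := fun x => - gaussianPDFReal 0 1 x)
    (f' := fun x => x * gaussianPDFReal 0 1 x) (m := 0)
    (hasDerivAt_gaussianPDFReal s).continuousAt.neg.continuousWithinAt
    (fun x _ => by simpa using! (hasDerivAt_gaussianPDFReal x).neg)
    integrable_mul_gaussianPDFReal.integrableOn (by simpa using! tendsto_gaussianPDFReal_atBot.neg)
  simpa [mul_comm] using this

/-- The covariance kernel `min p q * (1 - max p q)` of the Brownian bridge. -/
noncomputable def bridgeKernel (p q : ℝ≥0∞) : ℝ≥0∞ := min p q * (1 - max p q)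

@[fun_prop]
theorem measurable_bridgeKernel {α : Type*} [MeasurableSpace α] {f g : α → ℝ≥0∞}
    (hf : Measurable f) (hg : Measurable g) : Measurable fun a => bridgeKernel (f a) (g a) :=
  (hf.min hg).mul (measurable_const.sub (hf.max hg))

theorem bridgeKernel_comm (p q : ℝ≥0∞) : bridgeKernel p q = bridgeKernel q p := by
  simp [bridgeKernel, min_comm, max_comm]

theorem measurable_measure_Iic (μ : Measure ℝ) : Measurable fun g => μ (Iic g) :=
  Monotone.measurable fun _ _ h => measure_mono (Iic_subset_Iic.2 h)

theorem measurableSet_and {α : Type*} [MeasurableSpace α] {p q : α → Prop}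
    (hp : MeasurableSet {a | p a}) (hq : MeasurableSet {a | q a}) :
    MeasurableSet {a | p a ∧ q a} :=
  hp.inter hq

theorem prod_gaussianReal_separated {p q : ℝ≥0∞} (hp : p ≤ 1) (hq : q ≤ 1) :
    ((gaussianReal 0 1).prod (gaussianReal 0 1))
      {z | (gaussianReal 0 1 (Iic z.1) ≤ p ∧ p < gaussianReal 0 1 (Iic z.2)) ∧
        (gaussianReal 0 1 (Iic z.1) ≤ q ∧ q < gaussianReal 0 1 (Iic z.2))} = bridgeKernel p q := by
  have : {z : ℝ × ℝ | (gaussianReal 0 1 (Iic z.1) ≤ p ∧ p < gaussianReal 0 1 (Iic z.2)) ∧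
      (gaussianReal 0 1 (Iic z.1) ≤ q ∧ q < gaussianReal 0 1 (Iic z.2))} =
      {g | gaussianReal 0 1 (Iic g) ≤ min p q} ×ˢ {g | max p q < gaussianReal 0 1 (Iic g)} := by
    ext z
    simp only [mem_ofPred_eq, mem_prod, le_min_iff, max_lt_iff]
    tauto
  rw [this, Measure.prod_prod, gaussianReal_setOf_Iic_le (min_le_of_left_le hp),
    gaussianReal_setOf_lt_Iic (max_le hp hq), bridgeKernel]

/-- `T` is the quantile function of the distribution function `F`, with the standard Gaussian as
source. -/
def IsGaussianQuantile (F : ℝ → ℝ≥0∞) (T : ℝ → ℝ) : Prop :=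
  ∀ g x, T g ≤ x ↔ gaussianReal 0 1 (Iic g) ≤ F x

namespace IsGaussianQuantile

variable {F G : ℝ → ℝ≥0∞} {T R : ℝ → ℝ}

theorem monotone (hT : IsGaussianQuantile F T) : Monotone T := fun s t h =>
  (hT s (T t)).2 ((gaussianReal_Iic_le_Iic.2 h).trans ((hT t (T t)).1 le_rfl))

theorem measurable (hT : IsGaussianQuantile F T) : Measurable T := hT.monotone.measurable

theorem lt_iff (hT : IsGaussianQuantile F T) (g x : ℝ) :
    x < T g ↔ F x < gaussianReal 0 1 (Iic g) := by
  rw [← not_le, hT g x, not_le]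

theorem map_gaussianReal {μ : Measure ℝ} [IsProbabilityMeasure μ]
    (hT : IsGaussianQuantile (fun x => μ (Iic x)) T) : (gaussianReal 0 1).map T = μ := by
  have := Measure.isProbabilityMeasure_map (μ := gaussianReal 0 1) hT.measurable.aemeasurable
  refine Measure.ext_of_Iic _ _ fun x => ?_
  rw [Measure.map_apply hT.measurable measurableSet_Iic, ← gaussianReal_setOf_Iic_le
    (prob_le_one (μ := μ) (s := Iic x))]
  congr 1
  ext g
  exact hT g x

theorem measure_Iic_apply {μ : Measure ℝ} [IsProbabilityMeasure μ] [NullSingletonClass μ]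
    (hT : IsGaussianQuantile (fun x => μ (Iic x)) T) (g : ℝ) :
    μ (Iic (T g)) = gaussianReal 0 1 (Iic g) := by
  refine le_antisymm ?_ ((hT g (T g)).1 le_rfl)
  have hc := (continuous_cdf_of_nullSingletonClass μ).continuousWithinAt (s := Iio (T g)) (x := T g)
  rw [← ofReal_cdf, ← ofReal_cdf]
  refine ENNReal.ofReal_le_ofReal (le_of_tendsto hc ?_)
  filter_upwards [self_mem_nhdsWithin] with x hx
  have := ((hT.lt_iff g x).1 hx).le
  rwa [← ofReal_cdf, ← ofReal_cdf, ENNReal.ofReal_le_ofReal_iff (cdf_nonneg _ _)] at this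

theorem lintegral_bridgeKernel_right (hR : IsGaussianQuantile G R) (hG : ∀ y, G y ≤ 1)
    {p : ℝ≥0∞} (hp : p ≤ 1) :
    ∫⁻ y, bridgeKernel p (G y) = ∫⁻ z, {z : ℝ × ℝ | gaussianReal 0 1 (Iic z.1) ≤ p ∧
        p < gaussianReal 0 1 (Iic z.2)}.indicator (fun z => ENNReal.ofReal (R z.2 - R z.1)) z
      ∂((gaussianReal 0 1).prod (gaussianReal 0 1)) := by
  set A := {z : ℝ × ℝ | gaussianReal 0 1 (Iic z.1) ≤ p ∧ p < gaussianReal 0 1 (Iic z.2)} with hA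
  have hRm := hR.measurable
  have hAm : MeasurableSet A :=
    measurableSet_and (measurableSet_le ((measurable_measure_Iic _).comp measurable_fst)
      measurable_const) (measurableSet_lt measurable_const
      ((measurable_measure_Iic _).comp measurable_snd))
  have hBm : MeasurableSet {w : ℝ × (ℝ × ℝ) | w.2 ∈ A ∧ (R w.2.1 ≤ w.1 ∧ w.1 < R w.2.2)} :=
    measurableSet_and (measurable_snd hAm) (measurableSet_and
      (measurableSet_le (by fun_prop) (by fun_prop)) (measurableSet_lt (by fun_prop) (by fun_prop)))
  have h1 : ∀ y, bridgeKernel p (G y) = ∫⁻ z, {w : ℝ × (ℝ × ℝ) | w.2 ∈ A ∧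
      (R w.2.1 ≤ w.1 ∧ w.1 < R w.2.2)}.indicator 1 (y, z)
      ∂((gaussianReal 0 1).prod (gaussianReal 0 1)) := by
    intro y
    rw [← prod_gaussianReal_separated hp (hG y)]
    simp_rw [← hR.lt_iff, ← hR _ _]
    exact (lintegral_indicator_one (measurable_prodMk_left (x := y) hBm)).symm
  simp_rw [h1]
  rw [lintegral_lintegral_swap]
  swap
  · exact (measurable_one.indicator hBm).aemeasurable
  refine lintegral_congr fun z => ?_
  by_cases hz : z ∈ A
  · rw [indicator_of_mem hz, ← Real.volume_Ico, ← lintegral_indicator_one measurableSet_Ico]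
    refine lintegral_congr fun y => ?_
    simp [indicator, hz]
  · simp [hz]

/-- Hoeffding's covariance formula for quantile couplings. -/
theorem lintegral_bridgeKernel (hT : IsGaussianQuantile F T) (hR : IsGaussianQuantile G R)
    (hF : ∀ x, F x ≤ 1) (hG : ∀ y, G y ≤ 1) :
    ∫⁻ x, ∫⁻ y, bridgeKernel (F x) (G y) =
      ∫⁻ z, ENNReal.ofReal (T z.2 - T z.1) * ENNReal.ofReal (R z.2 - R z.1)
        ∂((gaussianReal 0 1).prod (gaussianReal 0 1)) := by
  have hTm := hT.measurable
  have hRm := hR.measurable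
  simp_rw [fun x => hR.lintegral_bridgeKernel_right hG (hF x), ← hT.lt_iff, ← hT _ _]
  have hBm : MeasurableSet {w : ℝ × (ℝ × ℝ) | T w.2.1 ≤ w.1 ∧ w.1 < T w.2.2} :=
    measurableSet_and (measurableSet_le (by fun_prop) (by fun_prop))
      (measurableSet_lt (by fun_prop) (by fun_prop))
  have h1 : ∀ (x : ℝ) (z : ℝ × ℝ), {z : ℝ × ℝ | T z.1 ≤ x ∧ x < T z.2}.indicator
      (fun z => ENNReal.ofReal (R z.2 - R z.1)) z = {w : ℝ × (ℝ × ℝ) | T w.2.1 ≤ w.1 ∧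
        w.1 < T w.2.2}.indicator (fun w => ENNReal.ofReal (R w.2.2 - R w.2.1)) (x, z) :=
    fun x z => rfl
  simp_rw [h1]
  rw [lintegral_lintegral_swap]
  · refine lintegral_congr fun z => ?_
    rw [← Real.volume_Ico, mul_comm, ← setLIntegral_const, ← lintegral_indicator measurableSet_Ico]
    rfl
  · exact (Measurable.indicator (by fun_prop) hBm).aemeasurable

end IsGaussianQuantile

theorem isGaussianQuantile_id :
    IsGaussianQuantile (fun x => gaussianReal 0 1 (Iic x)) (fun x => x) :=
  fun _ _ => gaussianReal_Iic_le_Iic.symm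

/-- The bridge kernel in Gaussian coordinates has Gaussian marginals. -/
theorem lintegral_bridgeKernel_gaussianReal (s : ℝ) :
    ∫⁻ t, bridgeKernel (gaussianReal 0 1 (Iic s)) (gaussianReal 0 1 (Iic t)) =
      gaussianPDF 0 1 s := by
  rw [isGaussianQuantile_id.lintegral_bridgeKernel_right (fun _ => prob_le_one) prob_le_one]
  simp_rw [gaussianReal_Iic_le_Iic, ← isGaussianQuantile_id.lt_iff]
  have hset : {z : ℝ × ℝ | z.1 ≤ s ∧ s < z.2} = Iic s ×ˢ Ioi s := by ext; simp
  have hi := integrable_id_gaussianReal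
  rw [hset, lintegral_indicator (measurableSet_Iic.prod measurableSet_Ioi),
    ← Measure.prod_restrict, ← ofReal_integral_eq_lintegral_ofReal]
  · rw [integral_sub, integral_fun_snd (f := fun x : ℝ => x), integral_fun_fst (f := fun x : ℝ => x),
      setIntegral_Iic_gaussianReal, setIntegral_Ioi_gaussianReal, gaussianPDF]
    · congr 1
      have : (gaussianReal 0 1).real (Iic s) + (gaussianReal 0 1).real (Ioi s) = 1 := by
        rw [← compl_Iic]; exact probReal_add_probReal_compl measurableSet_Iic
      simp only [measureReal_restrict_apply_univ, smul_eq_mul]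
      linear_combination (gaussianPDFReal 0 1 s) * this
    · exact hi.restrict.comp_snd _
    · exact hi.restrict.comp_fst _
  · exact (hi.restrict.comp_snd _).sub (hi.restrict.comp_fst _)
  · rw [Measure.prod_restrict]
    filter_upwards [ae_restrict_mem (measurableSet_Iic.prod measurableSet_Ioi)] with z hz
    have h1 : z.1 ≤ s := hz.1
    have h2 : s < z.2 := hz.2
    simp
    linarith

/-- A Lebesgue density of a measure that is absolutely continuous with respect to the standard
Gaussian. -/
noncomputable def gaussianDensity (μ : Measure ℝ) (x : ℝ) : ℝ≥0∞ :=
  gaussianPDF 0 1 x * μ.rnDeriv (gaussianReal 0 1) x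

theorem measurable_gaussianDensity (μ : Measure ℝ) : Measurable (gaussianDensity μ) :=
  (measurable_gaussianPDF 0 1).mul (Measure.measurable_rnDeriv _ _)

theorem withDensity_gaussianDensity {μ : Measure ℝ} [IsProbabilityMeasure μ]
    (h : μ ≪ gaussianReal 0 1) : volume.withDensity (gaussianDensity μ) = μ := by
  have := withDensity_mul volume (measurable_gaussianPDF 0 1)
    (Measure.measurable_rnDeriv μ (gaussianReal 0 1))
  rw [← gaussianReal_of_var_ne_zero 0 one_ne_zero, Measure.withDensity_rnDeriv_eq _ _ h] at this
  exact this

theorem lintegral_mul_inv_gaussianDensity_le {μ : Measure ℝ} [IsProbabilityMeasure μ]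
    (h : μ ≪ gaussianReal 0 1) {f : ℝ → ℝ≥0∞} (hf : Measurable f) :
    ∫⁻ x, f x * (gaussianDensity μ x)⁻¹ ∂μ ≤ ∫⁻ x, f x := by
  have hd := measurable_gaussianDensity μ
  have key := lintegral_withDensity_eq_lintegral_mul volume hd
    (g := fun x => f x * (gaussianDensity μ x)⁻¹) (hf.mul hd.inv)
  rw [withDensity_gaussianDensity h] at key
  rw [key]
  refine lintegral_mono fun x => ?_
  simp only [Pi.mul_apply]
  calc gaussianDensity μ x * (f x * (gaussianDensity μ x)⁻¹)
      = f x * (gaussianDensity μ x * (gaussianDensity μ x)⁻¹) := by ring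
    _ ≤ f x * 1 := by gcongr; exact ENNReal.mul_inv_le_one _
    _ = f x := mul_one _

theorem lintegral_gaussianReal {f : ℝ → ℝ≥0∞} (hf : Measurable f) :
    ∫⁻ x, f x ∂(gaussianReal 0 1) = ∫⁻ x, gaussianPDF 0 1 x * f x := by
  rw [gaussianReal_of_var_ne_zero _ one_ne_zero,
    lintegral_withDensity_eq_lintegral_mul _ (measurable_gaussianPDF 0 1) hf]
  rfl

/-- The measure on the plane whose Lebesgue density is the bridge kernel in Gaussian coordinates. -/
noncomputable def bridgeMeasure : Measure (ℝ × ℝ) :=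
  (volume.prod volume).withDensity
    fun z => bridgeKernel (gaussianReal 0 1 (Iic z.1)) (gaussianReal 0 1 (Iic z.2))

theorem measurable_bridgeDensity : Measurable fun z : ℝ × ℝ =>
    bridgeKernel (gaussianReal 0 1 (Iic z.1)) (gaussianReal 0 1 (Iic z.2)) :=
  measurable_bridgeKernel ((measurable_measure_Iic _).comp measurable_fst)
    ((measurable_measure_Iic _).comp measurable_snd)

theorem lintegral_bridgeMeasure {f : ℝ × ℝ → ℝ≥0∞} (hf : Measurable f) :
    ∫⁻ z, f z ∂bridgeMeasure = ∫⁻ s, ∫⁻ t,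
      bridgeKernel (gaussianReal 0 1 (Iic s)) (gaussianReal 0 1 (Iic t)) * f (s, t) := by
  rw [bridgeMeasure, lintegral_withDensity_eq_lintegral_mul _ measurable_bridgeDensity hf,
    lintegral_prod _ (measurable_bridgeDensity.mul hf).aemeasurable]
  rfl

theorem map_fst_bridgeMeasure : bridgeMeasure.map Prod.fst = gaussianReal 0 1 := by
  ext s hs
  rw [Measure.map_apply measurable_fst hs, ← lintegral_indicator_one (measurable_fst hs),
    lintegral_bridgeMeasure (measurable_one.indicator (measurable_fst hs)),
    ← lintegral_indicator_one hs, lintegral_gaussianReal (measurable_one.indicator hs)]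
  refine lintegral_congr fun x => ?_
  rw [← lintegral_bridgeKernel_gaussianReal, ← lintegral_mul_const]
  · rfl
  · exact measurable_bridgeDensity.comp measurable_prodMk_left

theorem map_snd_bridgeMeasure : bridgeMeasure.map Prod.snd = gaussianReal 0 1 := by
  have hm := measurable_bridgeDensity
  ext s hs
  have hi := measurable_one.indicator (measurable_snd (α := ℝ) hs) (f := (1 : ℝ × ℝ → ℝ≥0∞))
  rw [Measure.map_apply measurable_snd hs, ← lintegral_indicator_one (measurable_snd hs),
    lintegral_bridgeMeasure hi, lintegral_lintegral_swap (hm.mul hi).aemeasurable,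
    ← lintegral_indicator_one hs, lintegral_gaussianReal (measurable_one.indicator hs)]
  refine lintegral_congr fun x => ?_
  rw [← lintegral_bridgeKernel_gaussianReal, ← lintegral_mul_const]
  · simp_rw [bridgeKernel_comm (gaussianReal 0 1 (Iic x))]
    rfl
  · exact hm.comp measurable_prodMk_left

instance : IsProbabilityMeasure bridgeMeasure :=
  ⟨by rw [← preimage_univ (f := Prod.fst), ← Measure.map_apply measurable_fst .univ,
    map_fst_bridgeMeasure, measure_univ]⟩

theorem log_toReal_gaussianPDF (x : ℝ) :
    Real.log (gaussianPDF 0 1 x).toReal = -Real.log √(2 * Real.pi) - x ^ 2 / 2 := by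
  rw [toReal_gaussianPDF, gaussianPDFReal, Real.log_mul (by positivity) (Real.exp_pos _).ne',
    Real.log_exp, Real.log_inv]
  simp
  ring

theorem integral_sq_gaussianReal : ∫ x, x ^ 2 ∂(gaussianReal 0 1) = 1 := by
  have h := variance_id_gaussianReal (μ := 0) (v := 1)
  rw [variance_eq_sub (memLp_id_gaussianReal' 2 (by simp))] at h
  simpa using h

namespace IsGaussianQuantile

variable {μ ν : Measure ℝ} [IsProbabilityMeasure μ] [IsProbabilityMeasure ν] {T R : ℝ → ℝ}

theorem ae_comp (hT : IsGaussianQuantile (fun x => μ (Iic x)) T) {p : ℝ → Prop}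
    (h : ∀ᵐ x ∂μ, p x) : ∀ᵐ s ∂(gaussianReal 0 1), p (T s) := by
  rw [← hT.map_gaussianReal] at h
  exact ae_of_ae_map hT.measurable.aemeasurable h

theorem integrable_comp (hT : IsGaussianQuantile (fun x => μ (Iic x)) T) {f : ℝ → ℝ}
    (h : Integrable f μ) : Integrable (fun s => f (T s)) (gaussianReal 0 1) := by
  rw [← hT.map_gaussianReal] at h
  exact h.comp_measurable hT.measurable

theorem memLp_comp (hT : IsGaussianQuantile (fun x => μ (Iic x)) T)
    (h : MemLp (fun x : ℝ => x) 2 μ) : MemLp T 2 (gaussianReal 0 1) := by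
  rw [← hT.map_gaussianReal] at h
  exact h.comp_of_map hT.measurable.aemeasurable

theorem integral_comp (hT : IsGaussianQuantile (fun x => μ (Iic x)) T) {f : ℝ → ℝ}
    (hf : AEStronglyMeasurable f μ) :
    ∫ s, f (T s) ∂(gaussianReal 0 1) = ∫ x, f x ∂μ := by
  rw [← hT.map_gaussianReal] at hf
  rw [← integral_map hT.measurable.aemeasurable hf, hT.map_gaussianReal]

theorem lintegral_comp (hT : IsGaussianQuantile (fun x => μ (Iic x)) T) {f : ℝ → ℝ≥0∞}
    (hf : Measurable f) :
    ∫⁻ x, f x ∂μ = ∫⁻ s, f (T s) ∂(gaussianReal 0 1) := by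
  rw [← lintegral_map hf hT.measurable, hT.map_gaussianReal]

/-- The ratio of the Gaussian density and the transported density: a lower bound for the derivative
of the quantile function. -/
noncomputable def slope (μ : Measure ℝ) (T : ℝ → ℝ) (s : ℝ) : ℝ≥0∞ :=
  gaussianPDF 0 1 s * (gaussianDensity μ (T s))⁻¹

omit [IsProbabilityMeasure μ] in
theorem measurable_slope (hT : Measurable T) : Measurable (slope μ T) :=
  (measurable_gaussianPDF 0 1).mul ((measurable_gaussianDensity μ).comp hT).inv

theorem log_slope (hT : IsGaussianQuantile (fun x => μ (Iic x)) T) (hμ : μ ≪ gaussianReal 0 1) :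
    ∀ᵐ s ∂(gaussianReal 0 1), 0 < (slope μ T s).toReal ∧ Real.log (slope μ T s).toReal =
      T s ^ 2 / 2 - s ^ 2 / 2 - llr μ (gaussianReal 0 1) (T s) := by
  filter_upwards [hT.ae_comp (Measure.rnDeriv_pos hμ),
    hT.ae_comp (hμ.ae_le (Measure.rnDeriv_lt_top μ (gaussianReal 0 1)))] with s h0 h1
  have hr := ENNReal.toReal_pos h0.ne' h1.ne
  have hp (x : ℝ) := ENNReal.toReal_pos (gaussianPDF_pos 0 one_ne_zero x).ne' gaussianPDF_ne_top
  simp only [slope, gaussianDensity, toReal_mul, toReal_inv]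
  have := hp s
  have := hp (T s)
  refine ⟨by positivity, ?_⟩
  rw [Real.log_mul (by positivity) (by positivity), Real.log_inv,
    Real.log_mul (by positivity) (by positivity), log_toReal_gaussianPDF, log_toReal_gaussianPDF,
    llr]
  ring

theorem integrable_log_slope (hT : IsGaussianQuantile (fun x => μ (Iic x)) T)
    (hμ : klDiv μ (gaussianReal 0 1) ≠ ∞) (hμ2 : MemLp (fun x : ℝ => x) 2 μ) :
    Integrable (fun s => Real.log (slope μ T s).toReal) (gaussianReal 0 1) := by
  obtain ⟨hac, hint⟩ := klDiv_ne_top_iff.1 hμ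
  refine (integrable_congr ((hT.log_slope hac).mono fun s hs => hs.2)).2 ?_
  exact (((hT.memLp_comp hμ2).integrable_sq.div_const 2).sub
    ((memLp_id_gaussianReal' 2 (by simp)).integrable_sq.div_const 2)).sub (hT.integrable_comp hint)

theorem integral_log_slope (hT : IsGaussianQuantile (fun x => μ (Iic x)) T)
    (hμ : klDiv μ (gaussianReal 0 1) ≠ ∞) (hμ2 : MemLp (fun x : ℝ => x) 2 μ) :
    ∫ s, Real.log (slope μ T s).toReal ∂(gaussianReal 0 1) =
      (∫ x, x ^ 2 ∂μ) / 2 - 1 / 2 - (klDiv μ (gaussianReal 0 1)).toReal := by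
  obtain ⟨hac, hint⟩ := klDiv_ne_top_iff.1 hμ
  have h1 := (hT.memLp_comp hμ2).integrable_sq.div_const 2
  have h2 : Integrable (fun s : ℝ => s ^ 2 / 2) (gaussianReal 0 1) :=
    (memLp_id_gaussianReal' (μ := 0) (v := 1) 2 (by simp)).integrable_sq.div_const 2
  rw [integral_congr_ae ((hT.log_slope hac).mono fun s hs => hs.2),
    integral_sub (f := fun s => T s ^ 2 / 2 - s ^ 2 / 2) (h1.sub h2) (hT.integrable_comp hint),
    integral_sub h1 h2, hT.integral_comp hint.1, toReal_klDiv_of_measure_eq hac (by simp),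
    integral_div, integral_div, hT.integral_comp (f := fun x => x ^ 2) hμ2.integrable_sq.1,
    integral_sq_gaussianReal]

theorem lintegral_slope_le (hT : IsGaussianQuantile (fun x => μ (Iic x)) T)
    (hR : IsGaussianQuantile (fun x => ν (Iic x)) R)
    (hμ : μ ≪ gaussianReal 0 1) (hν : ν ≪ gaussianReal 0 1) :
    ∫⁻ z, slope μ T z.1 * slope ν R z.2 ∂bridgeMeasure ≤
      ∫⁻ x, ∫⁻ y, bridgeKernel (μ (Iic x)) (ν (Iic y)) := by
  have hTm := hT.measurable
  have hRm := hR.measurable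
  have : NullSingletonClass μ := ⟨fun x => hμ (measure_singleton x)⟩
  have : NullSingletonClass ν := ⟨fun x => hν (measure_singleton x)⟩
  have hb : Measurable fun z : ℝ × ℝ => bridgeKernel (μ (Iic z.1)) (ν (Iic z.2)) :=
    measurable_bridgeKernel ((measurable_measure_Iic _).comp measurable_fst)
      ((measurable_measure_Iic _).comp measurable_snd)
  have hf : Measurable fun z : ℝ × ℝ =>
      bridgeKernel (μ (Iic z.1)) (ν (Iic z.2)) * (gaussianDensity ν z.2)⁻¹ :=
    hb.mul ((measurable_gaussianDensity ν).comp measurable_snd).inv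
  have hg : Measurable fun z : ℝ × ℝ => bridgeKernel (gaussianReal 0 1 (Iic z.1))
      (gaussianReal 0 1 (Iic z.2)) * (gaussianDensity ν (R z.2))⁻¹ :=
    measurable_bridgeDensity.mul
      (((measurable_gaussianDensity ν).comp hRm).comp measurable_snd).inv
  calc ∫⁻ z, slope μ T z.1 * slope ν R z.2 ∂bridgeMeasure
      = ∫⁻ s, (∫⁻ t, bridgeKernel (gaussianReal 0 1 (Iic s)) (gaussianReal 0 1 (Iic t)) *
          (gaussianDensity ν (R t))⁻¹ ∂(gaussianReal 0 1)) * (gaussianDensity μ (T s))⁻¹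
          ∂(gaussianReal 0 1) := by
        rw [lintegral_bridgeMeasure, lintegral_gaussianReal]
        · refine lintegral_congr fun s => ?_
          have hg1 : Measurable fun t => bridgeKernel (gaussianReal 0 1 (Iic s))
              (gaussianReal 0 1 (Iic t)) * (gaussianDensity ν (R t))⁻¹ :=
            hg.comp measurable_prodMk_left
          rw [lintegral_gaussianReal hg1, ← lintegral_mul_const, ← lintegral_const_mul]
          · refine lintegral_congr fun t => ?_
            simp only [slope]
            ring
          · exact ((measurable_gaussianPDF 0 1).mul hg1).mul_const _
          · exact (measurable_gaussianPDF 0 1).mul hg1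
        · exact hg.lintegral_prod_right'.mul ((measurable_gaussianDensity μ).comp hTm).inv
        · exact ((measurable_slope hTm).comp measurable_fst).mul
            ((measurable_slope hRm).comp measurable_snd)
    _ = ∫⁻ x, (∫⁻ y, bridgeKernel (μ (Iic x)) (ν (Iic y)) * (gaussianDensity ν y)⁻¹ ∂ν) *
          (gaussianDensity μ x)⁻¹ ∂μ := by
        rw [hT.lintegral_comp]
        · refine lintegral_congr fun s => ?_
          rw [hR.lintegral_comp (f := fun y => bridgeKernel (μ (Iic (T s))) (ν (Iic y)) *
            (gaussianDensity ν y)⁻¹) (hf.comp measurable_prodMk_left)]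
          simp_rw [hT.measure_Iic_apply, hR.measure_Iic_apply]
        · exact hf.lintegral_prod_right'.mul (measurable_gaussianDensity μ).inv
    _ ≤ ∫⁻ x, ∫⁻ y, bridgeKernel (μ (Iic x)) (ν (Iic y)) * (gaussianDensity ν y)⁻¹ ∂ν :=
        lintegral_mul_inv_gaussianDensity_le hμ hf.lintegral_prod_right'
    _ ≤ ∫⁻ x, ∫⁻ y, bridgeKernel (μ (Iic x)) (ν (Iic y)) :=
        lintegral_mono fun x =>
          lintegral_mul_inv_gaussianDensity_le hν (hb.comp measurable_prodMk_left)

end IsGaussianQuantile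

/-- The covariance of two comonotone square-integrable functions, via independent copies. -/
theorem lintegral_prod_ofReal_sub_mul_ofReal_sub {T R : ℝ → ℝ} (hT : Monotone T) (hR : Monotone R)
    {γ : Measure ℝ} [IsProbabilityMeasure γ] (hT2 : MemLp T 2 γ) (hR2 : MemLp R 2 γ) :
    0 ≤ ∫ s, T s * R s ∂γ - (∫ s, T s ∂γ) * ∫ s, R s ∂γ ∧
    ∫⁻ z, ENNReal.ofReal (T z.2 - T z.1) * ENNReal.ofReal (R z.2 - R z.1) ∂(γ.prod γ) =
      ENNReal.ofReal (∫ s, T s * R s ∂γ - (∫ s, T s ∂γ) * ∫ s, R s ∂γ) := by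
  have hTm := hT.measurable
  have hRm := hR.measurable
  have hT1 := hT2.integrable one_le_two
  have hR1 := hR2.integrable one_le_two
  have hTR : Integrable (fun s => T s * R s) γ := hT2.integrable_mul hR2
  have i1 : Integrable (fun z : ℝ × ℝ => T z.1 * R z.1) (γ.prod γ) := hTR.comp_fst γ
  have i2 : Integrable (fun z : ℝ × ℝ => T z.2 * R z.2) (γ.prod γ) := hTR.comp_snd γ
  have i3 : Integrable (fun z : ℝ × ℝ => T z.1 * R z.2) (γ.prod γ) := hT1.mul_prod hR1
  have i4 : Integrable (fun z : ℝ × ℝ => R z.1 * T z.2) (γ.prod γ) := hR1.mul_prod hT1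
  have hexp : (fun z : ℝ × ℝ => (T z.2 - T z.1) * (R z.2 - R z.1)) = fun z =>
      (T z.1 * R z.1 + T z.2 * R z.2) - (T z.1 * R z.2 + R z.1 * T z.2) := by
    ext z; ring
  have hint : Integrable (fun z : ℝ × ℝ => (T z.2 - T z.1) * (R z.2 - R z.1)) (γ.prod γ) := by
    rw [hexp]
    exact (i1.add i2).sub (i3.add i4)
  have hval : ∫ z, (T z.2 - T z.1) * (R z.2 - R z.1) ∂(γ.prod γ) =
      2 * (∫ s, T s * R s ∂γ - (∫ s, T s ∂γ) * ∫ s, R s ∂γ) := by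
    rw [hexp, integral_sub (f := fun z : ℝ × ℝ => T z.1 * R z.1 + T z.2 * R z.2)
      (g := fun z : ℝ × ℝ => T z.1 * R z.2 + R z.1 * T z.2) (i1.add i2) (i3.add i4),
      integral_add i1 i2, integral_add i3 i4, integral_prod_mul T R, integral_prod_mul R T,
      integral_fun_fst (fun s => T s * R s), integral_fun_snd (fun s => T s * R s)]
    simp
    ring
  have hnonneg (z : ℝ × ℝ) : 0 ≤ (T z.2 - T z.1) * (R z.2 - R z.1) := by
    rcases le_total z.1 z.2 with h | h
    · exact mul_nonneg (sub_nonneg.2 (hT h)) (sub_nonneg.2 (hR h))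
    · exact mul_nonneg_of_nonpos_of_nonpos (sub_nonpos.2 (hT h)) (sub_nonpos.2 (hR h))
  have hpos : 0 ≤ ∫ s, T s * R s ∂γ - (∫ s, T s ∂γ) * ∫ s, R s ∂γ := by
    have := integral_nonneg_of_ae (μ := γ.prod γ) (ae_of_all _ hnonneg)
    linarith
  refine ⟨hpos, ?_⟩
  set h : ℝ × ℝ → ℝ≥0∞ :=
    fun z => ENNReal.ofReal (T z.2 - T z.1) * ENNReal.ofReal (R z.2 - R z.1) with hh
  have hm : Measurable h := by fun_prop
  have hsum (z : ℝ × ℝ) :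
      h z + h z.swap = ENNReal.ofReal ((T z.2 - T z.1) * (R z.2 - R z.1)) := by
    simp only [hh, Prod.fst_swap, Prod.snd_swap]
    rcases le_total z.1 z.2 with h | h
    · rw [ENNReal.ofReal_of_nonpos (p := T z.1 - T z.2) (sub_nonpos.2 (hT h)), zero_mul, add_zero,
        ENNReal.ofReal_mul (sub_nonneg.2 (hT h))]
    · rw [ENNReal.ofReal_of_nonpos (p := T z.2 - T z.1) (sub_nonpos.2 (hT h)), zero_mul, zero_add,
        ← ENNReal.ofReal_mul (sub_nonneg.2 (hT h))]
      congr 1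
      ring
  have h2 : 2 * ∫⁻ z, h z ∂(γ.prod γ) =
      2 * ENNReal.ofReal (∫ s, T s * R s ∂γ - (∫ s, T s ∂γ) * ∫ s, R s ∂γ) := by
    calc 2 * ∫⁻ z, h z ∂(γ.prod γ) = ∫⁻ z, h z ∂(γ.prod γ) + ∫⁻ z, h z.swap ∂(γ.prod γ) := by
          rw [lintegral_prod_swap, two_mul]
      _ = ∫⁻ z, ENNReal.ofReal ((T z.2 - T z.1) * (R z.2 - R z.1)) ∂(γ.prod γ) := by
          rw [← lintegral_add_left hm]
          exact lintegral_congr hsum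
      _ = _ := by
          rw [← ofReal_integral_eq_lintegral_ofReal hint (ae_of_all _ hnonneg), hval,
            ENNReal.ofReal_mul zero_le_two]
          simp
  exact (ENNReal.mul_right_inj two_ne_zero ofNat_ne_top).1 h2

theorem ofReal_integral_le_lintegral_ofReal {α : Type*} [MeasurableSpace α] {m : Measure α}
    {f : α → ℝ} (hf : Integrable f m) :
    ENNReal.ofReal (∫ a, f a ∂m) ≤ ∫⁻ a, ENNReal.ofReal (f a) ∂m := by
  calc ENNReal.ofReal (∫ a, f a ∂m) ≤ ENNReal.ofReal (∫ a, max (f a) 0 ∂m) :=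
        ENNReal.ofReal_le_ofReal (integral_mono hf hf.pos_part fun a => le_max_left _ _)
    _ = ∫⁻ a, ENNReal.ofReal (max (f a) 0) ∂m :=
        ofReal_integral_eq_lintegral_ofReal hf.pos_part (ae_of_all _ fun a => le_max_right _ _)
    _ = ∫⁻ a, ENNReal.ofReal (f a) ∂m := by simp [ENNReal.ofReal_max]

theorem IsGaussianQuantile.le_covariance {μ ν : Measure ℝ} [IsProbabilityMeasure μ]
    [IsProbabilityMeasure ν] {T R : ℝ → ℝ}
    (hT : IsGaussianQuantile (fun x => μ (Iic x)) T)
    (hR : IsGaussianQuantile (fun x => ν (Iic x)) R)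
    (hμ : klDiv μ (gaussianReal 0 1) ≠ ∞) (hν : klDiv ν (gaussianReal 0 1) ≠ ∞)
    (hμ2 : MemLp (fun x : ℝ => x) 2 μ) (hν2 : MemLp (fun x : ℝ => x) 2 ν) :
    (∫ x, x ^ 2 ∂μ) / 2 + (∫ x, x ^ 2 ∂ν) / 2
      - (klDiv μ (gaussianReal 0 1)).toReal - (klDiv ν (gaussianReal 0 1)).toReal ≤
      ∫ s, T s * R s ∂(gaussianReal 0 1) - (∫ x, x ∂μ) * ∫ x, x ∂ν := by
  have hμac := (klDiv_ne_top_iff.1 hμ).1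
  have hνac := (klDiv_ne_top_iff.1 hν).1
  obtain ⟨hpos, hcov⟩ := lintegral_prod_ofReal_sub_mul_ofReal_sub hT.monotone hR.monotone
    (hT.memLp_comp hμ2) (hR.memLp_comp hν2)
  rw [hT.integral_comp (f := fun x => x) hμ2.1, hR.integral_comp (f := fun x => x) hν2.1]
    at hpos hcov
  have hi1 : Integrable (fun z => Real.log (slope μ T (Prod.fst z)).toReal) bridgeMeasure := by
    have := hT.integrable_log_slope hμ hμ2
    rw [← map_fst_bridgeMeasure] at this
    exact this.comp_measurable measurable_fst
  have hi2 : Integrable (fun z => Real.log (slope ν R (Prod.snd z)).toReal) bridgeMeasure := by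
    have := hR.integrable_log_slope hν hν2
    rw [← map_snd_bridgeMeasure] at this
    exact this.comp_measurable measurable_snd
  have hv1 : ∫ z, Real.log (slope μ T (Prod.fst z)).toReal ∂bridgeMeasure =
      ∫ s, Real.log (slope μ T s).toReal ∂(gaussianReal 0 1) := by
    have := (hT.integrable_log_slope hμ hμ2).1
    rw [← map_fst_bridgeMeasure] at this ⊢
    rw [integral_map measurable_fst.aemeasurable this]
  have hv2 : ∫ z, Real.log (slope ν R (Prod.snd z)).toReal ∂bridgeMeasure =
      ∫ s, Real.log (slope ν R s).toReal ∂(gaussianReal 0 1) := by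
    have := (hR.integrable_log_slope hν hν2).1
    rw [← map_snd_bridgeMeasure] at this ⊢
    rw [integral_map measurable_snd.aemeasurable this]
  have hi : Integrable (fun z : ℝ × ℝ => 1 + Real.log (slope μ T z.1).toReal +
      Real.log (slope ν R z.2).toReal) bridgeMeasure :=
    ((integrable_const 1).add hi1).add hi2
  have hval : ∫ z : ℝ × ℝ, (1 + Real.log (slope μ T z.1).toReal +
      Real.log (slope ν R z.2).toReal) ∂bridgeMeasure = (∫ x, x ^ 2 ∂μ) / 2 + (∫ x, x ^ 2 ∂ν) / 2
      - (klDiv μ (gaussianReal 0 1)).toReal - (klDiv ν (gaussianReal 0 1)).toReal := by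
    rw [integral_add (f := fun z : ℝ × ℝ => 1 + Real.log (slope μ T z.1).toReal)
      ((integrable_const 1).add hi1) hi2, integral_add (integrable_const 1) hi1, hv1, hv2,
      hT.integral_log_slope hμ hμ2, hR.integral_log_slope hν hν2]
    simp
    ring
  rw [← hval, ← ENNReal.ofReal_le_ofReal_iff hpos, ← hcov]
  calc ENNReal.ofReal (∫ z : ℝ × ℝ, (1 + Real.log (slope μ T z.1).toReal +
        Real.log (slope ν R z.2).toReal) ∂bridgeMeasure)
      ≤ ∫⁻ z : ℝ × ℝ, ENNReal.ofReal (1 + Real.log (slope μ T z.1).toReal +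
        Real.log (slope ν R z.2).toReal) ∂bridgeMeasure := ofReal_integral_le_lintegral_ofReal hi
    _ ≤ ∫⁻ z, slope μ T z.1 * slope ν R z.2 ∂bridgeMeasure := by
        have h1 := hT.log_slope hμac
        have h2 := hR.log_slope hνac
        rw [← map_fst_bridgeMeasure] at h1
        rw [← map_snd_bridgeMeasure] at h2
        refine lintegral_mono_ae ?_
        filter_upwards [ae_of_ae_map measurable_fst.aemeasurable h1,
          ae_of_ae_map measurable_snd.aemeasurable h2] with z hz1 hz2
        calc _ ≤ ENNReal.ofReal ((slope μ T z.1).toReal * (slope ν R z.2).toReal) := by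
              apply ENNReal.ofReal_le_ofReal
              have := Real.log_le_sub_one_of_pos (mul_pos hz1.1 hz2.1)
              rw [Real.log_mul hz1.1.ne' hz2.1.ne'] at this
              linarith
          _ ≤ _ := by
              rw [← toReal_mul]
              exact ENNReal.ofReal_toReal_le
    _ ≤ ∫⁻ x, ∫⁻ y, bridgeKernel (μ (Iic x)) (ν (Iic y)) := hT.lintegral_slope_le hR hμac hνac
    _ = _ := hT.lintegral_bridgeKernel hR (fun _ => prob_le_one) fun _ => prob_le_one

/-- The quantile function of `μ` in Gaussian coordinates. -/
noncomputable def gaussianQuantile (μ : Measure ℝ) (g : ℝ) : ℝ :=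
  sInf {x | gaussianReal 0 1 (Iic g) ≤ μ (Iic x)}

theorem isGaussianQuantile_gaussianQuantile (μ : Measure ℝ) [IsProbabilityMeasure μ] :
    IsGaussianQuantile (fun x => μ (Iic x)) (gaussianQuantile μ) := by
  intro g x
  set S := {x | gaussianReal 0 1 (Iic g) ≤ μ (Iic x)} with hS
  have hne : S.Nonempty := by
    have h := (tendsto_measure_Iic_atTop μ).eventually_const_lt
      (by rw [measure_univ]; exact gaussianReal_Iic_lt_one g)
    obtain ⟨y, hy⟩ := h.exists
    exact ⟨y, hy.le⟩
  have hbdd : BddBelow S := by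
    have h0 : Tendsto (fun y => μ (Iic y)) atBot (𝓝 0) := by
      simpa [Function.comp_def, ofReal_cdf] using
        (ENNReal.continuous_ofReal.tendsto _).comp (tendsto_cdf_atBot μ)
    have h := h0.eventually_lt_const (gaussianReal_Iic_pos g)
    obtain ⟨y, hy⟩ := h.exists
    refine ⟨y, fun z hz => ?_⟩
    by_contra! hlt
    exact absurd ((hz : _ ≤ _).trans (measure_mono (Iic_subset_Iic.2 hlt.le))) (not_le.2 hy)
  refine ⟨fun h => ?_, fun h => csInf_le hbdd h⟩
  have hlim : Tendsto (fun y => μ (Iic y)) (𝓝[>] x) (𝓝 (μ (Iic x))) := by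
    have := ((cdf μ).right_continuous x).mono_left (nhdsWithin_mono x Ioi_subset_Ici_self)
    simpa [Function.comp_def, ofReal_cdf] using (ENNReal.continuous_ofReal.tendsto _).comp this
  refine ge_of_tendsto hlim ?_
  filter_upwards [self_mem_nhdsWithin] with y hy
  obtain ⟨z, hz, hzy⟩ := exists_lt_of_csInf_lt hne (h.trans_lt hy)
  exact (hz : _ ≤ _).trans (measure_mono (Iic_subset_Iic.2 hzy.le))

theorem measurable_gaussianQuantile {A : Type*} [MeasurableSpace A] (κ : Kernel A ℝ)
    [IsMarkovKernel κ] : Measurable fun z : A × ℝ => gaussianQuantile (κ z.1) z.2 := by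
  refine measurable_of_Iic fun x => ?_
  have : (fun z : A × ℝ => gaussianQuantile (κ z.1) z.2) ⁻¹' Iic x =
      {z | gaussianReal 0 1 (Iic z.2) ≤ κ z.1 (Iic x)} := by
    ext z
    exact isGaussianQuantile_gaussianQuantile (κ z.1) z.2 x
  rw [this]
  exact measurableSet_le ((measurable_measure_Iic _).comp measurable_snd)
    ((κ.measurable_coe measurableSet_Iic).comp measurable_fst)

/-- The covariance of the coupling `π` of `μ` and `ν`, in the coordinates `e`, controls the
relative entropies with respect to `γ`. -/
def CouplingBound {ι E : Type*} [Fintype ι] [MeasurableSpace E] (e : ι → E → ℝ)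
    (γ μ ν : Measure E) (π : Measure (E × E)) : Prop :=
  klDiv μ γ ≠ ∞ → klDiv ν γ ≠ ∞ → (∀ i, MemLp (e i) 2 μ) → (∀ i, MemLp (e i) 2 ν) →
    ∑ i, ((∫ x, e i x ^ 2 ∂μ) / 2 + (∫ x, e i x ^ 2 ∂ν) / 2
      - (∫ p, e i p.1 * e i p.2 ∂π - (∫ x, e i x ∂μ) * ∫ x, e i x ∂ν)) ≤
      (klDiv μ γ).toReal + (klDiv ν γ).toReal

/-- Measurable families of probability measures admit measurable families of couplings that satisfy
`CouplingBound`. -/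
def HasCouplings {ι E : Type*} [Fintype ι] [MeasurableSpace E] (e : ι → E → ℝ)
    (γ : Measure E) : Prop :=
  ∀ (A : Type) [MeasurableSpace A] (κ η : Kernel A E) [IsMarkovKernel κ] [IsMarkovKernel η],
    ∃ π : Kernel A (E × E), IsMarkovKernel π ∧ π.fst = κ ∧ π.snd = η ∧
      ∀ a, CouplingBound e γ (κ a) (η a) (π a)

theorem hasCouplings_gaussianReal :
    HasCouplings (fun (_ : Unit) (x : ℝ) => x) (gaussianReal 0 1) := by
  intro A _ κ η _ _
  have hκ := measurable_gaussianQuantile κ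
  have hη := measurable_gaussianQuantile η
  have hm : Measurable fun z : A × ℝ =>
      (gaussianQuantile (κ z.1) z.2, gaussianQuantile (η z.1) z.2) := hκ.prodMk hη
  let π : Kernel A (ℝ × ℝ) := (Kernel.id ×ₖ Kernel.const A (gaussianReal 0 1)).map
    fun z : A × ℝ => (gaussianQuantile (κ z.1) z.2, gaussianQuantile (η z.1) z.2)
  have hπ (a : A) : π a = (gaussianReal 0 1).map
      fun g => (gaussianQuantile (κ a) g, gaussianQuantile (η a) g) := by
    rw [Kernel.map_apply _ hm, Kernel.prod_apply, Kernel.id_apply, Kernel.const_apply,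
      Measure.dirac_prod, Measure.map_map hm measurable_prodMk_left]
    rfl
  have hT (a : A) := isGaussianQuantile_gaussianQuantile (κ a)
  have hR (a : A) := isGaussianQuantile_gaussianQuantile (η a)
  refine ⟨π, Kernel.IsMarkovKernel.map _ hm, ?_, ?_, fun a h1 h2 h3 h4 => ?_⟩
  · ext1 a
    rw [Kernel.fst_apply, hπ, Measure.map_map measurable_fst
      ((hT a).measurable.prodMk (hR a).measurable)]
    exact (hT a).map_gaussianReal
  · ext1 a
    rw [Kernel.snd_apply, hπ, Measure.map_map measurable_snd
      ((hT a).measurable.prodMk (hR a).measurable)]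
    exact (hR a).map_gaussianReal
  · have := (hT a).le_covariance (hR a) h1 h2 (h3 ()) (h4 ())
    rw [Fintype.sum_unique, hπ, integral_map
      ((hT a).measurable.prodMk (hR a).measurable).aemeasurable (by fun_prop)]
    linarith

theorem klDiv_compProd_right_ae_eq {E F : Type*} [MeasurableSpace E] [MeasurableSpace F]
    [MeasurableSpace.CountableOrCountablyGenerated E F] {μ : Measure E} [IsFiniteMeasure μ]
    {k l : Kernel E F} [IsMarkovKernel k] [IsMarkovKernel l] (h : μ ⊗ₘ k ≪ μ ⊗ₘ l) :
    AEMeasurable (fun x => klDiv (k x) (l x)) μ ∧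
      klDiv (μ ⊗ₘ k) (μ ⊗ₘ l) = ∫⁻ x, klDiv (k x) (l x) ∂μ := by
  set r : E × F → ℝ≥0∞ := fun p => Kernel.rnDeriv k l p.1 p.2 with hr
  have hrm : Measurable r := Kernel.measurable_rnDeriv k l
  have hac := Measure.absolutelyContinuous_compProd_right_iff.1 h
  have hdens : (μ ⊗ₘ l).withDensity r = μ ⊗ₘ k := by
    ext s hs
    rw [withDensity_apply _ hs, ← lintegral_indicator hs,
      Measure.lintegral_compProd (hrm.indicator hs), Measure.compProd_apply hs]
    refine lintegral_congr_ae (hac.mono fun x hx => ?_)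
    beta_reduce
    rw [← Kernel.withDensity_rnDeriv_eq hx, Kernel.withDensity_apply' _
      (Kernel.measurable_rnDeriv k l), ← lintegral_indicator (measurable_prodMk_left hs)]
    rfl
  have hrn : (μ ⊗ₘ k).rnDeriv (μ ⊗ₘ l) =ᵐ[μ ⊗ₘ l] r := by
    rw [← hdens]
    exact Measure.rnDeriv_withDensity _ hrm
  have hm : Measurable fun p => ENNReal.ofReal (klFun (r p).toReal) :=
    (measurable_klFun.comp hrm.ennreal_toReal).ennreal_ofReal
  have hkl : (fun x => klDiv (k x) (l x)) =ᵐ[μ]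
      fun x => ∫⁻ y, ENNReal.ofReal (klFun (r (x, y)).toReal) ∂(l x) := by
    filter_upwards [hac] with x hx
    rw [klDiv_eq_lintegral_klFun_of_ac hx]
    refine lintegral_congr_ae ?_
    filter_upwards [Kernel.rnDeriv_eq_rnDeriv_measure (κ := k) (η := l) (a := x)] with y hy
    rw [← hy]
  refine ⟨⟨_, hm.lintegral_kernel_prod_right', hkl⟩, ?_⟩
  rw [klDiv_eq_lintegral_klFun_of_ac h, lintegral_congr_ae hkl, ← Measure.lintegral_compProd hm]
  exact lintegral_congr_ae (hrn.mono fun p hp => by simp only [hp])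

theorem klDiv_compProd_prod_ne_top {E F : Type*} [MeasurableSpace E] [MeasurableSpace F]
    [MeasurableSpace.CountableOrCountablyGenerated E F] {μ γ : Measure E} {γ' : Measure F}
    [IsProbabilityMeasure μ] [IsProbabilityMeasure γ] [IsProbabilityMeasure γ']
    {k : Kernel E F} [IsMarkovKernel k] (h : klDiv (μ ⊗ₘ k) (γ.prod γ') ≠ ∞) :
    klDiv μ γ ≠ ∞ ∧ (∀ᵐ x ∂μ, klDiv (k x) γ' ≠ ∞) ∧
      Integrable (fun x => (klDiv (k x) γ').toReal) μ ∧
      (klDiv μ γ).toReal + ∫ x, (klDiv (k x) γ').toReal ∂μ =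
        (klDiv (μ ⊗ₘ k) (γ.prod γ')).toReal := by
  rw [← Measure.compProd_const] at h ⊢
  have hac := (Measure.absolutelyContinuous_compProd_iff.1 (klDiv_ne_top_iff.1 h).1).2
  obtain ⟨hm, heq⟩ := klDiv_compProd_right_ae_eq hac
  simp only [Kernel.const_apply] at hm heq
  rw [klDiv_compProd_eq_add, heq] at h ⊢
  obtain ⟨h1, h2⟩ := add_ne_top.1 h
  have hfin := ae_lt_top' hm h2
  refine ⟨h1, hfin.mono fun x hx => hx.ne, integrable_toReal_of_lintegral_ne_top hm h2, ?_⟩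
  rw [integral_toReal hm hfin, toReal_add h1 h2]

theorem integrable_integral_of_compProd {B E : Type*} [MeasurableSpace B] [MeasurableSpace E]
    {θ : Measure B} [SFinite θ] {l : Kernel B E} [IsSFiniteKernel l] {f : B × E → ℝ}
    (h : Integrable f (θ ⊗ₘ l)) : Integrable (fun b => ∫ x, f (b, x) ∂(l b)) θ := by
  simpa using! MeasureTheory.Integrable.integral_compProd (a := ()) h

theorem ae_memLp_two_of_compProd {B E : Type*} [MeasurableSpace B] [MeasurableSpace E]
    {θ : Measure B} [SFinite θ] {l : Kernel B E} [IsSFiniteKernel l] {f : E → ℝ}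
    (hf : Measurable f) (h : MemLp (fun z : B × E => f z.2) 2 (θ ⊗ₘ l)) :
    ∀ᵐ b ∂θ, MemLp f 2 (l b) := by
  have h2 := h.integrable_sq
  filter_upwards [((Measure.integrable_compProd_iff h2.1).1 h2).1] with b hb
  exact (memLp_two_iff_integrable_sq hf.aestronglyMeasurable).2 hb

/-- Averaging a coupling bound over a family of couplings with one common marginal. -/
theorem CouplingBound.average {B E ι : Type*} [Fintype ι] [MeasurableSpace B] [MeasurableSpace E]
    {e : ι → E → ℝ} (he : ∀ i, Measurable (e i)) {γ μ : Measure E} {θ : Measure B}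
    [IsProbabilityMeasure θ] [IsProbabilityMeasure μ]
    {l : Kernel B E} [IsMarkovKernel l] {π : Kernel B (E × E)} [IsMarkovKernel π]
    (hfst : ∀ b, (π b).map Prod.fst = μ) (hsnd : ∀ b, (π b).map Prod.snd = l b)
    (hπ : ∀ b, CouplingBound e γ μ (l b) (π b)) (hμ : klDiv μ γ ≠ ∞)
    (hl : ∀ᵐ b ∂θ, klDiv (l b) γ ≠ ∞) (hli : Integrable (fun b => (klDiv (l b) γ).toReal) θ)
    (hμ2 : ∀ i, MemLp (e i) 2 μ) (hl2 : ∀ i, MemLp (fun z : B × E => e i z.2) 2 (θ ⊗ₘ l)) :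
    ∑ i, ((∫ x, e i x ^ 2 ∂μ) / 2 + (∫ z, e i z.2 ^ 2 ∂(θ ⊗ₘ l)) / 2
      - (∫ z, e i z.2.1 * e i z.2.2 ∂(θ ⊗ₘ π) - (∫ x, e i x ∂μ) * ∫ z, e i z.2 ∂(θ ⊗ₘ l))) ≤
      (klDiv μ γ).toReal + ∫ b, (klDiv (l b) γ).toReal ∂θ := by
  have hmap1 : (θ ⊗ₘ π).map (fun z => z.2.1) = μ := by
    ext s hs
    have (b : B) : π b (Prod.mk b ⁻¹' ((fun z : B × (E × E) => z.2.1) ⁻¹' s)) = μ s := by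
      rw [← hfst b, Measure.map_apply measurable_fst hs]
      rfl
    rw [Measure.map_apply (by fun_prop) hs, Measure.compProd_apply (hs.preimage (by fun_prop))]
    simp [this]
  have hmap2 : (θ ⊗ₘ π).map (fun z => (z.1, z.2.2)) = θ ⊗ₘ l := by
    ext s hs
    rw [Measure.map_apply (by fun_prop) hs, Measure.compProd_apply (hs.preimage (by fun_prop)),
      Measure.compProd_apply hs]
    refine lintegral_congr fun b => ?_
    rw [← hsnd b, Measure.map_apply measurable_snd (measurable_prodMk_left hs)]
    rfl
  have hi1 (i : ι) : Integrable (fun z : B × (E × E) => e i z.2.1 * e i z.2.2) (θ ⊗ₘ π) := by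
    have h1 := hμ2 i
    have h2 := hl2 i
    rw [← hmap1] at h1
    rw [← hmap2] at h2
    exact (h1.comp_of_map (by fun_prop)).integrable_mul (h2.comp_of_map (by fun_prop))
  have hi2 (i : ι) : Integrable (fun z : B × E => e i z.2 ^ 2) (θ ⊗ₘ l) := (hl2 i).integrable_sq
  have hi3 (i : ι) : Integrable (fun z : B × E => e i z.2) (θ ⊗ₘ l) :=
    (hl2 i).integrable one_le_two
  have j1 (i : ι) := integrable_integral_of_compProd (hi1 i)
  have j2 (i : ι) := integrable_integral_of_compProd (hi2 i)
  have j3 (i : ι) := integrable_integral_of_compProd (hi3 i)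
  have k1 (i : ι) : Integrable (fun b => (∫ x, e i x ^ 2 ∂μ) / 2 + (∫ x, e i x ^ 2 ∂(l b)) / 2) θ :=
    (integrable_const _).add ((j2 i).div_const 2)
  have k2 (i : ι) : Integrable (fun b => ∫ p, e i p.1 * e i p.2 ∂(π b) -
      (∫ x, e i x ∂μ) * ∫ x, e i x ∂(l b)) θ :=
    (j1 i).sub ((j3 i).const_mul _)
  have k3 (i : ι) : Integrable (fun b => (∫ x, e i x ^ 2 ∂μ) / 2 + (∫ x, e i x ^ 2 ∂(l b)) / 2
      - (∫ p, e i p.1 * e i p.2 ∂(π b) - (∫ x, e i x ∂μ) * ∫ x, e i x ∂(l b))) θ :=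
    (k1 i).sub (k2 i)
  have key : ∫ b, ∑ i, ((∫ x, e i x ^ 2 ∂μ) / 2 + (∫ x, e i x ^ 2 ∂(l b)) / 2
      - (∫ p, e i p.1 * e i p.2 ∂(π b) - (∫ x, e i x ∂μ) * ∫ x, e i x ∂(l b))) ∂θ ≤
      ∫ b, ((klDiv μ γ).toReal + (klDiv (l b) γ).toReal) ∂θ := by
    refine integral_mono_ae (integrable_finsetSum _ fun i _ => k3 i)
      ((integrable_const _).add hli) ?_
    filter_upwards [hl, eventually_all.2 fun i => ae_memLp_two_of_compProd (he i) (hl2 i)]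
      with b hb1 hb2
    exact hπ b hμ hb1 hμ2 hb2
  rw [integral_finsetSum _ fun i _ => k3 i,
    integral_add (integrable_const _) hli] at key
  simp only [integral_const, probReal_univ, one_smul] at key
  refine (Finset.sum_congr rfl fun i _ => ?_).trans_le key
  rw [integral_sub (k1 i) (k2 i), integral_add (integrable_const _) ((j2 i).div_const 2),
    integral_sub (j1 i) ((j3 i).const_mul _), integral_const_mul, integral_div (f := fun b => ∫ x, e i x ^ 2 ∂(l b)),
    Measure.integral_compProd (hi1 i), Measure.integral_compProd (hi2 i),
    Measure.integral_compProd (hi3 i)]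
  simp

theorem klDiv_map_measurableEquiv {E E' : Type*} [MeasurableSpace E] [MeasurableSpace E']
    (μ γ : Measure E) [IsFiniteMeasure μ] [IsFiniteMeasure γ] (φ : E ≃ᵐ E') :
    klDiv (μ.map φ) (γ.map φ) = klDiv μ γ := by
  refine le_antisymm (klDiv_map_le _ _ φ.measurable) ?_
  have := klDiv_map_le (μ.map φ) (γ.map φ) φ.symm.measurable
  simpa [Measure.map_map φ.symm.measurable φ.measurable] using this

theorem exists_kernel_glue {A Z U V : Type*} [MeasurableSpace A] [MeasurableSpace Z]
    [MeasurableSpace U] [MeasurableSpace V] [MeasurableSpace.CountableOrCountablyGenerated A Z]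
    [StandardBorelSpace U] [Nonempty U] [StandardBorelSpace V] [Nonempty V]
    (ρ₁ : Kernel A (Z × U)) (ρ₂ : Kernel A (Z × V)) [IsMarkovKernel ρ₁] [IsMarkovKernel ρ₂]
    (h : ρ₁.fst = ρ₂.fst) :
    ∃ ρ : Kernel A (Z × (U × V)), IsMarkovKernel ρ ∧
      ρ.map (fun p => (p.1, p.2.1)) = ρ₁ ∧ ρ.map (fun p => (p.1, p.2.2)) = ρ₂ := by
  refine ⟨ρ₁.fst ⊗ₖ (ρ₁.condKernel ×ₖ ρ₂.condKernel), inferInstance, ?_, ?_⟩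
  · conv_rhs => rw [← ρ₁.disintegrate ρ₁.condKernel]
    ext a s hs
    rw [Kernel.map_apply' _ (by fun_prop) _ hs,
      Kernel.compProd_apply (hs.preimage (by fun_prop)), Kernel.compProd_apply hs]
    refine lintegral_congr fun z => ?_
    conv_rhs => rw [← Kernel.fst_prod ρ₁.condKernel ρ₂.condKernel]
    rw [Kernel.fst_apply' _ _ (measurable_prodMk_left hs)]
    rfl
  · conv_rhs => rw [← ρ₂.disintegrate ρ₂.condKernel, ← h]
    ext a s hs
    rw [Kernel.map_apply' _ (by fun_prop) _ hs,
      Kernel.compProd_apply (hs.preimage (by fun_prop)), Kernel.compProd_apply hs]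
    refine lintegral_congr fun z => ?_
    conv_rhs => rw [← Kernel.snd_prod ρ₁.condKernel ρ₂.condKernel]
    rw [Kernel.snd_apply' _ _ (measurable_prodMk_left hs)]
    rfl

/-- Coupling bounds tensorize when the two marginals are disintegrated in opposite orders. -/
theorem CouplingBound.prod {E F ι κ : Type*} [Fintype ι] [Fintype κ] [MeasurableSpace E]
    [MeasurableSpace F] [MeasurableSpace.CountableOrCountablyGenerated E F]
    [MeasurableSpace.CountableOrCountablyGenerated F E] {e : ι → E → ℝ} {f : κ → F → ℝ}
    (he : ∀ i, Measurable (e i)) (hf : ∀ j, Measurable (f j)) {γE μE : Measure E}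
    {γF νF : Measure F} [IsProbabilityMeasure γE] [IsProbabilityMeasure γF]
    [IsProbabilityMeasure μE] [IsProbabilityMeasure νF] {k : Kernel E F} {l : Kernel F E}
    [IsMarkovKernel k] [IsMarkovKernel l] {π₁ : Kernel F (E × E)} {π₂ : Kernel E (F × F)}
    [IsMarkovKernel π₁] [IsMarkovKernel π₂]
    (hfst₁ : ∀ b, (π₁ b).map Prod.fst = μE) (hsnd₁ : ∀ b, (π₁ b).map Prod.snd = l b)
    (h₁ : ∀ b, CouplingBound e γE μE (l b) (π₁ b))
    (hfst₂ : ∀ b, (π₂ b).map Prod.fst = νF) (hsnd₂ : ∀ b, (π₂ b).map Prod.snd = k b)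
    (h₂ : ∀ b, CouplingBound f γF νF (k b) (π₂ b))
    {π : Measure ((E × F) × (E × F))}
    (hE : π.map (fun p => (p.1.1, p.2.1)) = (νF ⊗ₘ π₁).map Prod.snd)
    (hF : π.map (fun p => (p.2.2, p.1.2)) = (μE ⊗ₘ π₂).map Prod.snd) :
    CouplingBound (Sum.elim (fun i x => e i x.1) fun j x => f j x.2) (γE.prod γF)
      (μE ⊗ₘ k) ((νF ⊗ₘ l).map Prod.swap) π := by
  intro hμ hν hμ2 hν2
  have hsw : klDiv ((νF ⊗ₘ l).map Prod.swap) (γE.prod γF) =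
      klDiv (νF ⊗ₘ l) (γF.prod γE) := by
    rw [← Measure.prod_swap]
    exact klDiv_map_measurableEquiv _ _ MeasurableEquiv.prodComm
  rw [hsw] at hν ⊢
  obtain ⟨hμ0, hk, hki, hμeq⟩ := klDiv_compProd_prod_ne_top hμ
  obtain ⟨hν0, hl, hli, hνeq⟩ := klDiv_compProd_prod_ne_top hν
  have hμE : (μE ⊗ₘ k).map Prod.fst = μE := Measure.fst_compProd μE k
  have hνF : (νF ⊗ₘ l).map Prod.fst = νF := Measure.fst_compProd νF l
  have iμ {g : E → ℝ} (hg : Measurable g) : ∫ x, g x.1 ∂(μE ⊗ₘ k) = ∫ x, g x ∂μE := by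
    rw [← integral_map (by fun_prop) (by fun_prop), hμE]
  have iν {g : F → ℝ} (hg : Measurable g) :
      ∫ x, g x.2 ∂((νF ⊗ₘ l).map Prod.swap) = ∫ x, g x ∂νF := by
    conv_rhs => rw [← hνF, integral_map (by fun_prop) hg.aestronglyMeasurable]
    exact integral_map measurable_swap.aemeasurable (hg.comp measurable_snd).aestronglyMeasurable
  have iν' {g : E → ℝ} (hg : Measurable g) :
      ∫ x, g x.1 ∂((νF ⊗ₘ l).map Prod.swap) = ∫ z, g z.2 ∂(νF ⊗ₘ l) :=
    integral_map measurable_swap.aemeasurable (hg.comp measurable_fst).aestronglyMeasurable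
  have iE (i : ι) : ∫ p, e i p.1.1 * e i p.2.1 ∂π =
      ∫ z, e i z.2.1 * e i z.2.2 ∂(νF ⊗ₘ π₁) := by
    have := he i
    rw [← integral_map (φ := Prod.snd) (f := fun q : E × E => e i q.1 * e i q.2) (by fun_prop)
      (by fun_prop), ← hE, integral_map (by fun_prop) (by fun_prop)]
  have iF (j : κ) : ∫ p, f j p.1.2 * f j p.2.2 ∂π =
      ∫ z, f j z.2.1 * f j z.2.2 ∂(μE ⊗ₘ π₂) := by
    have := hf j
    rw [← integral_map (φ := Prod.snd) (f := fun q : F × F => f j q.1 * f j q.2) (by fun_prop)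
      (by fun_prop), ← hF, integral_map (by fun_prop) (by fun_prop)]
    simp_rw [mul_comm]
  have m1 (i : ι) : MemLp (e i) 2 μE := by
    rw [← hμE]
    exact (memLp_map_measure_iff (he i).aestronglyMeasurable (by fun_prop)).2 (hμ2 (.inl i))
  have m2 (i : ι) : MemLp (fun z : F × E => e i z.2) 2 (νF ⊗ₘ l) :=
    (hν2 (.inl i)).comp_of_map (by fun_prop)
  have m3 (j : κ) : MemLp (f j) 2 νF := by
    rw [← hνF]
    exact (memLp_map_measure_iff (hf j).aestronglyMeasurable (by fun_prop)).2
      ((hν2 (.inr j)).comp_of_map (by fun_prop))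
  have m4 (j : κ) : MemLp (fun z : E × F => f j z.2) 2 (μE ⊗ₘ k) := hμ2 (.inr j)
  have bE := CouplingBound.average he hfst₁ hsnd₁ h₁ hμ0 hl hli m1 m2
  have bF := CouplingBound.average hf hfst₂ hsnd₂ h₂ hν0 hk hki m3 m4
  rw [Fintype.sum_sum_type, ← hμeq, ← hνeq]
  simp only [Sum.elim_inl, Sum.elim_inr, iE, iF]
  have sE : ∀ i, ∫ x, e i x.1 ^ 2 ∂(μE ⊗ₘ k) = ∫ x, e i x ^ 2 ∂μE := fun i =>
    iμ ((he i).pow_const 2)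
  have sE' : ∀ i, ∫ x, e i x.1 ^ 2 ∂((νF ⊗ₘ l).map Prod.swap) = ∫ z, e i z.2 ^ 2 ∂(νF ⊗ₘ l) :=
    fun i => iν' ((he i).pow_const 2)
  have sF : ∀ j, ∫ x, f j x.2 ^ 2 ∂((νF ⊗ₘ l).map Prod.swap) = ∫ x, f j x ^ 2 ∂νF := fun j =>
    iν ((hf j).pow_const 2)
  simp only [sE, sE', sF, iμ (he _), iν (hf _), iν' (he _)]
  calc _ ≤ _ := add_le_add bE ((Finset.sum_congr rfl fun j _ => by ring).trans_le bF)
    _ = _ := by ring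

theorem compProd_map_prodMap_id {E F G : Type*} [MeasurableSpace E] [MeasurableSpace F]
    [MeasurableSpace G] (μ : Measure E) [SFinite μ] (k : Kernel E F) [IsSFiniteKernel k]
    {g : F → G} (hg : Measurable g) {k' : Kernel E G} (h : ∀ b, (k b).map g = k' b) :
    (μ ⊗ₘ k).map (Prod.map id g) = μ ⊗ₘ k' := by
  rw [← Measure.compProd_map hg]
  congr 1
  ext1 b
  rw [Kernel.map_apply _ hg, h]

theorem HasCouplings.prod {E F ι κ : Type} [Fintype ι] [Fintype κ] [MeasurableSpace E]
    [MeasurableSpace F] [StandardBorelSpace E] [StandardBorelSpace F] [Nonempty E] [Nonempty F]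
    {e : ι → E → ℝ} {f : κ → F → ℝ} (he : ∀ i, Measurable (e i)) (hf : ∀ j, Measurable (f j))
    {γE : Measure E} {γF : Measure F} [IsProbabilityMeasure γE] [IsProbabilityMeasure γF]
    (hE : HasCouplings e γE) (hF : HasCouplings f γF) :
    HasCouplings (Sum.elim (fun i (x : E × F) => e i x.1) fun j x => f j x.2) (γE.prod γF) := by
  intro A _ κ η _ _
  set η' : Kernel A (F × E) := η.map Prod.swap with hη'
  have : IsMarkovKernel η' := Kernel.IsMarkovKernel.map _ measurable_swap
  obtain ⟨π₁, _, hfst₁, hsnd₁, h₁⟩ := hE (A × F) (κ.fst.prodMkRight F) η'.condKernel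
  obtain ⟨π₂, _, hfst₂, hsnd₂, h₂⟩ := hF (A × E) (η'.fst.prodMkRight E) κ.condKernel
  have hκa (a : A) : κ.fst a ⊗ₘ κ.condKernel.sectR a = κ a := by
    rw [← Kernel.compProd_apply_eq_compProd_sectR, κ.disintegrate]
  have hηa (a : A) : (η'.fst a ⊗ₘ η'.condKernel.sectR a).map Prod.swap = η a := by
    rw [← Kernel.compProd_apply_eq_compProd_sectR, η'.disintegrate, hη',
      Kernel.map_apply _ measurable_swap, Measure.map_map measurable_swap measurable_swap]
    simp
  have hf₁ (a : A) (b : F) : (π₁.sectR a b).map Prod.fst = κ.fst a := by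
    rw [Kernel.sectR_apply, ← Kernel.fst_apply, hfst₁, Kernel.prodMkRight_apply]
  have hs₁ (a : A) (b : F) : (π₁.sectR a b).map Prod.snd = η'.condKernel.sectR a b := by
    rw [Kernel.sectR_apply, ← Kernel.snd_apply, hsnd₁, Kernel.sectR_apply]
  have hf₂ (a : A) (b : E) : (π₂.sectR a b).map Prod.fst = η'.fst a := by
    rw [Kernel.sectR_apply, ← Kernel.fst_apply, hfst₂, Kernel.prodMkRight_apply]
  have hs₂ (a : A) (b : E) : (π₂.sectR a b).map Prod.snd = κ.condKernel.sectR a b := by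
    rw [Kernel.sectR_apply, ← Kernel.snd_apply, hsnd₂, Kernel.sectR_apply]
  have hm₁ : Measurable fun w : F × (E × E) => ((w.2.1, w.1), w.2.2) := by fun_prop
  have hm₂ : Measurable fun w : E × (F × F) => ((w.1, w.2.1), w.2.2) := by fun_prop
  set ρ₁ : Kernel A ((E × F) × E) := (η'.fst ⊗ₖ π₁).map fun w => ((w.2.1, w.1), w.2.2) with hρ₁
  set ρ₂ : Kernel A ((E × F) × F) := (κ.fst ⊗ₖ π₂).map fun w => ((w.1, w.2.1), w.2.2) with hρ₂
  have : IsMarkovKernel ρ₁ := Kernel.IsMarkovKernel.map _ hm₁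
  have : IsMarkovKernel ρ₂ := Kernel.IsMarkovKernel.map _ hm₂
  have hρ₁a {G : Type} [MeasurableSpace G] {g : (E × F) × E → G} (hg : Measurable g) (a : A) :
      (ρ₁ a).map g =
        (η'.fst a ⊗ₘ π₁.sectR a).map fun w => g ((w.2.1, w.1), w.2.2) := by
    rw [hρ₁, Kernel.map_apply _ hm₁, Kernel.compProd_apply_eq_compProd_sectR,
      Measure.map_map hg hm₁]
    rfl
  have hρ₂a {G : Type} [MeasurableSpace G] {g : (E × F) × F → G} (hg : Measurable g) (a : A) :
      (ρ₂ a).map g =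
        (κ.fst a ⊗ₘ π₂.sectR a).map fun w => g ((w.1, w.2.1), w.2.2) := by
    rw [hρ₂, Kernel.map_apply _ hm₂, Kernel.compProd_apply_eq_compProd_sectR,
      Measure.map_map hg hm₂]
    rfl
  have hfst : ρ₁.fst = ρ₂.fst := by
    ext1 a
    have i₁ := compProd_map_prodMap_id (η'.fst a) (π₁.sectR a) measurable_fst
      (k' := Kernel.const F (κ.fst a)) (hf₁ a)
    have i₂ := compProd_map_prodMap_id (κ.fst a) (π₂.sectR a) measurable_fst
      (k' := Kernel.const E (η'.fst a)) (hf₂ a)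
    rw [Measure.compProd_const] at i₁ i₂
    rw [Kernel.fst_apply, Kernel.fst_apply, hρ₁a measurable_fst, hρ₂a measurable_fst]
    calc _ = ((η'.fst a ⊗ₘ π₁.sectR a).map (Prod.map id Prod.fst)).map Prod.swap := by
          rw [Measure.map_map measurable_swap (by fun_prop)]
          rfl
      _ = _ := by
          rw [i₁, Measure.prod_swap, ← i₂]
          rfl
  obtain ⟨ρ, _, hr₁, hr₂⟩ := exists_kernel_glue ρ₁ ρ₂ hfst
  have hm : Measurable fun q : (E × F) × (E × F) => ((q.1.1, q.2.2), (q.2.1, q.1.2)) := by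
    fun_prop
  have hr₁a {G : Type} [MeasurableSpace G] {g : (E × F) × E → G} (hg : Measurable g) (a : A) :
      (ρ a).map (fun q => g (q.1, q.2.1)) =
        (η'.fst a ⊗ₘ π₁.sectR a).map fun w => g ((w.2.1, w.1), w.2.2) := by
    rw [← hρ₁a hg, ← hr₁, Kernel.map_apply _ (by fun_prop), Measure.map_map hg (by fun_prop)]
    rfl
  have hr₂a {G : Type} [MeasurableSpace G] {g : (E × F) × F → G} (hg : Measurable g) (a : A) :
      (ρ a).map (fun q => g (q.1, q.2.2)) =
        (κ.fst a ⊗ₘ π₂.sectR a).map fun w => g ((w.1, w.2.1), w.2.2) := by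
    rw [← hρ₂a hg, ← hr₂, Kernel.map_apply _ (by fun_prop), Measure.map_map hg (by fun_prop)]
    rfl
  refine ⟨ρ.map fun q => ((q.1.1, q.2.2), (q.2.1, q.1.2)),
    Kernel.IsMarkovKernel.map _ hm, ?_, ?_, fun a => ?_⟩
  · ext1 a
    rw [Kernel.fst_apply, Kernel.map_apply _ hm, Measure.map_map measurable_fst hm, ← hκa a,
      ← compProd_map_prodMap_id _ _ measurable_snd (hs₂ a)]
    exact hr₂a (g := fun w => (w.1.1, w.2)) (by fun_prop) a
  · ext1 a
    rw [Kernel.snd_apply, Kernel.map_apply _ hm, Measure.map_map measurable_snd hm, ← hηa a,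
      ← compProd_map_prodMap_id _ _ measurable_snd (hs₁ a),
      Measure.map_map measurable_swap (by fun_prop)]
    exact hr₁a (g := fun w => (w.2, w.1.2)) (by fun_prop) a
  · rw [← hκa a, ← hηa a]
    refine CouplingBound.prod he hf (hf₁ a) (hs₁ a) (fun b => ?_) (hf₂ a) (hs₂ a) (fun b => ?_)
      ?_ ?_
    · exact h₁ (a, b)
    · exact h₂ (a, b)
    · rw [Kernel.map_apply _ hm, Measure.map_map (by fun_prop) hm]
      exact hr₁a (g := fun w => (w.1.1, w.2)) (by fun_prop) a
    · rw [Kernel.map_apply _ hm, Measure.map_map (by fun_prop) hm]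
      exact hr₂a (g := fun w => (w.1.2, w.2)) (by fun_prop) a

theorem CouplingBound.map {E E' ι ι' : Type*} [Fintype ι] [Fintype ι'] [MeasurableSpace E]
    [MeasurableSpace E'] {e : ι → E → ℝ} {e' : ι' → E' → ℝ} {γ μ ν : Measure E}
    [IsFiniteMeasure γ] [IsFiniteMeasure μ] [IsFiniteMeasure ν] {π : Measure (E × E)}
    (φ : E ≃ᵐ E') (σ : ι ≃ ι') (h : ∀ i x, e' (σ i) (φ x) = e i x)
    (H : CouplingBound e γ μ ν π) :
    CouplingBound e' (γ.map φ) (μ.map φ) (ν.map φ) (π.map (Prod.map φ φ)) := by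
  intro hμ hν hμ2 hν2
  rw [klDiv_map_measurableEquiv] at hμ hν ⊢
  rw [klDiv_map_measurableEquiv]
  have hm (i : ι) : e' (σ i) ∘ φ = e i := funext (h i)
  have hL {m : Measure E} (H : ∀ i, MemLp (e' i) 2 (m.map φ)) (i : ι) : MemLp (e i) 2 m := by
    rw [← hm i]
    exact φ.memLp_map_measure_iff.1 (H (σ i))
  convert! H hμ hν (hL hμ2) (hL hν2) using 1
  rw [← σ.sum_comp]
  refine Finset.sum_congr rfl fun i _ => ?_
  have := integral_map_equiv (μ := π) (φ.prodCongr φ) fun p => e' (σ i) p.1 * e' (σ i) p.2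
  change ∫ p, _ ∂(π.map (Prod.map φ φ)) = ∫ p, e' (σ i) (φ p.1) * e' (σ i) (φ p.2) ∂π at this
  rw [this]
  simp only [integral_map_equiv, h]

theorem HasCouplings.map {E E' ι ι' : Type*} [Fintype ι] [Fintype ι'] [MeasurableSpace E]
    [MeasurableSpace E'] {e : ι → E → ℝ} {e' : ι' → E' → ℝ} {γ : Measure E} {γ' : Measure E'}
    [IsFiniteMeasure γ] (φ : E ≃ᵐ E') (hφ : MeasurePreserving φ γ γ') (σ : ι ≃ ι')
    (h : ∀ i x, e' (σ i) (φ x) = e i x) (H : HasCouplings e γ) : HasCouplings e' γ' := by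
  intro A _ κ η _ _
  have := Kernel.IsMarkovKernel.map κ φ.symm.measurable
  have := Kernel.IsMarkovKernel.map η φ.symm.measurable
  obtain ⟨π, _, h₁, h₂, hπ⟩ := H A (κ.map φ.symm) (η.map φ.symm)
  have hm : Measurable (Prod.map φ φ) := φ.measurable.prodMap φ.measurable
  have hφφ (m : Measure E') : (m.map φ.symm).map φ = m := by
    rw [Measure.map_map φ.measurable φ.symm.measurable]
    simp
  refine ⟨π.map (Prod.map φ φ), Kernel.IsMarkovKernel.map _ hm, ?_, ?_, fun a => ?_⟩
  · ext1 a
    rw [Kernel.fst_apply, Kernel.map_apply _ hm, Measure.map_map measurable_fst hm,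
      Prod.map_fst', ← Measure.map_map φ.measurable measurable_fst, ← Kernel.fst_apply, h₁,
      Kernel.map_apply _ φ.symm.measurable, hφφ]
  · ext1 a
    rw [Kernel.snd_apply, Kernel.map_apply _ hm, Measure.map_map measurable_snd hm,
      Prod.map_snd', ← Measure.map_map φ.measurable measurable_snd, ← Kernel.snd_apply, h₂,
      Kernel.map_apply _ φ.symm.measurable, hφφ]
  · have := (hπ a).map φ σ h
    rwa [hφ.map_eq, Kernel.map_apply _ φ.symm.measurable, Kernel.map_apply _ φ.symm.measurable,
      hφφ, hφφ, ← Kernel.map_apply _ hm] at this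

theorem hasCouplings_of_isEmpty {E ι : Type*} [Fintype ι] [IsEmpty ι] [MeasurableSpace E]
    (e : ι → E → ℝ) (γ : Measure E) : HasCouplings e γ := by
  intro A _ κ η _ _
  refine ⟨κ ×ₖ η, inferInstance, Kernel.fst_prod κ η, Kernel.snd_prod κ η, fun a _ _ _ _ => ?_⟩
  simpa using add_nonneg toReal_nonneg toReal_nonneg

theorem hasCouplings_pi_gaussianReal (n : ℕ) :
    HasCouplings (fun (i : Fin n) (x : Fin n → ℝ) => x i)
      (Measure.pi fun _ => gaussianReal 0 1) := by
  induction n with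
  | zero => exact hasCouplings_of_isEmpty _ _
  | succ n ih =>
    have hp := HasCouplings.prod (fun _ => measurable_id) (fun j => measurable_pi_apply j)
      hasCouplings_gaussianReal ih
    refine hp.map (MeasurableEquiv.piFinSuccAbove (fun _ => ℝ) 0).symm
      (measurePreserving_piFinSuccAbove (fun _ => gaussianReal 0 1) 0).symm
      ((Equiv.sumComm _ _).trans <| (Equiv.optionEquivSumPUnit (Fin n)).symm.trans
        (finSuccEquiv n).symm) ?_
    rintro (i | i) x
    · simp [MeasurableEquiv.piFinSuccAbove, MeasurableEquiv.symm]
    · simp [MeasurableEquiv.piFinSuccAbove, MeasurableEquiv.symm]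

theorem MeasureTheory.MeasurePreserving.withDensity_comp {E E' : Type*} [MeasurableSpace E]
    [MeasurableSpace E'] {μ : Measure E} {ν : Measure E'} {φ : E ≃ᵐ E'}
    (hφ : MeasurePreserving φ μ ν) (g : E' → ℝ≥0∞) :
    MeasurePreserving φ (μ.withDensity (g ∘ φ)) (ν.withDensity g) := by
  refine ⟨φ.measurable, ?_⟩
  ext s hs
  rw [φ.map_apply, withDensity_apply _ hs, withDensity_apply _ (φ.measurable hs)]
  exact hφ.setLIntegral_comp_preimage_emb φ.measurableEmbedding g s

theorem pi_withDensity_fin {X : Type*} [MeasurableSpace X] (μ : Measure X) [SigmaFinite μ]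
    {g : X → ℝ≥0∞} (hg : Measurable g) [SigmaFinite (μ.withDensity g)] (n : ℕ) :
    Measure.pi (fun _ : Fin n => μ.withDensity g) =
      (Measure.pi fun _ => μ).withDensity fun x => ∏ i, g (x i) := by
  induction n with
  | zero =>
    rw [Measure.pi_of_empty _ Fin.elim0, Measure.pi_of_empty _ Fin.elim0]
    simp
  | succ n ih =>
    have h₁ := (measurePreserving_piFinSuccAbove (fun _ : Fin (n + 1) => μ.withDensity g) 0).symm
    have h₂ := (measurePreserving_piFinSuccAbove (fun _ : Fin (n + 1) => μ) 0).symm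
    have h₃ := h₂.withDensity_comp fun x => ∏ i, g (x i)
    rw [← h₁.map_eq, ← h₃.map_eq]
    congr 1
    rw [ih, prod_withDensity hg (by fun_prop)]
    congr 1
    ext x
    simp [Fin.prod_univ_succ, MeasurableEquiv.piFinSuccAbove, MeasurableEquiv.symm]

end

section
open Set Filter Topology InformationTheory

theorem relEntropy_eq_klDiv {E : Type*} [MeasurableSpace E] (μ γ : Measure E)
    [IsProbabilityMeasure μ] [IsProbabilityMeasure γ] : relEntropy μ γ = klDiv μ γ := by
  simp [relEntropy, klDiv]

theorem measurePreserving_toLp_stdGaussian (n : ℕ) :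
    MeasurePreserving (MeasurableEquiv.toLp 2 (Fin n → ℝ))
      (Measure.pi fun _ => ProbabilityTheory.gaussianReal 0 1) (stdGaussian n) := by
  have h := (EuclideanSpace.volume_preserving_symm_measurableEquiv_toLp (Fin n)).symm
  have hd := h.withDensity_comp fun x : EuclideanSpace ℝ (Fin n) =>
    ENNReal.ofReal ((2 * Real.pi) ^ (-(n : ℝ) / 2) * Real.exp (-‖x‖ ^ 2 / 2))
  have := ProbabilityTheory.gaussianReal_of_var_ne_zero 0 one_ne_zero
  convert! hd using 1
  have hs : SigmaFinite (volume.withDensity (ProbabilityTheory.gaussianPDF 0 1)) := by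
    rw [← this]
    infer_instance
  rw [this, pi_withDensity_fin _ (ProbabilityTheory.measurable_gaussianPDF 0 1), volume_pi]
  congr 1
  ext x
  simp only [ProbabilityTheory.gaussianPDF, Function.comp_apply]
  rw [← ENNReal.ofReal_prod_of_nonneg fun i _ => ProbabilityTheory.gaussianPDFReal_nonneg 0 1 _]
  congr 1
  simp only [ProbabilityTheory.gaussianPDFReal, Finset.prod_mul_distrib, ← Real.exp_sum]
  congr 1
  · rw [Finset.prod_const, Finset.card_univ, Fintype.card_fin, NNReal.coe_one, mul_one,
      Real.sqrt_eq_rpow, ← Real.rpow_neg Real.two_pi_pos.le,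
      ← Real.rpow_mul_natCast Real.two_pi_pos.le]
    ring_nf
  · simp [EuclideanSpace.norm_sq_eq, Finset.sum_div, neg_div]

theorem hasCouplings_stdGaussian (n : ℕ) :
    HasCouplings (fun (i : Fin n) (x : EuclideanSpace ℝ (Fin n)) => x i) (stdGaussian n) :=
  (hasCouplings_pi_gaussianReal n).map _ (measurePreserving_toLp_stdGaussian n) (Equiv.refl _)
    fun _ _ => rfl

theorem isProbabilityMeasure_stdGaussian (n : ℕ) : IsProbabilityMeasure (stdGaussian n) :=
  (measurePreserving_toLp_stdGaussian n).map_eq ▸ Measure.isProbabilityMeasure_map (by fun_prop)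

theorem memLp_two_id_of_lintegral {E : Type*} [NormedAddCommGroup E] [MeasurableSpace E]
    [BorelSpace E] [SecondCountableTopology E] {μ : Measure E} (h : ∫⁻ x, ‖x‖₊ ^ 2 ∂μ < ∞) :
    MemLp id 2 μ := by
  refine (memLp_two_iff_integrable_sq_norm measurable_id.aestronglyMeasurable).2 ?_
  refine ⟨by fun_prop, ?_⟩
  simpa [HasFiniteIntegral, enorm_pow, enorm_eq_nnnorm] using h

end

/-- The symmetrized Talagrand transport-entropy inequality:
`W₂(μ,ν)² ≤ 2 D(μ‖γ) + 2 D(ν‖γ)` for `μ` centered. -/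
theorem symmetrized_talagrand {n : ℕ} (hn : 1 ≤ n)
    (μ ν : Measure (EuclideanSpace ℝ (Fin n)))
    [IsProbabilityMeasure μ] [IsProbabilityMeasure ν]
    (hμ2 : ∫⁻ x, ‖x‖₊ ^ 2 ∂μ < ∞) (hν2 : ∫⁻ x, ‖x‖₊ ^ 2 ∂ν < ∞)
    (hcent : ∫ x, x ∂μ = 0) :
    ⨅ π : {π : Measure (EuclideanSpace ℝ (Fin n) × EuclideanSpace ℝ (Fin n)) //
        IsProbabilityMeasure π ∧ IsCoupling π μ ν},
        ∫⁻ p, ‖p.1 - p.2‖₊ ^ 2 ∂(π : Measure (EuclideanSpace ℝ (Fin n) × EuclideanSpace ℝ (Fin n))) ≤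
      2 * relEntropy μ (stdGaussian n) + 2 * relEntropy ν (stdGaussian n) := by
  have := isProbabilityMeasure_stdGaussian n
  rw [relEntropy_eq_klDiv, relEntropy_eq_klDiv]
  by_cases hμ : InformationTheory.klDiv μ (stdGaussian n) = ∞
  · simp [hμ]
  by_cases hν : InformationTheory.klDiv ν (stdGaussian n) = ∞
  · simp [hν]
  obtain ⟨κ, _, h₁, h₂, hκ⟩ := hasCouplings_stdGaussian n Unit
    (ProbabilityTheory.Kernel.const Unit μ) (ProbabilityTheory.Kernel.const Unit ν)
  set π := κ () with hπ
  have hfst : π.map Prod.fst = μ := by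
    rw [hπ, ← ProbabilityTheory.Kernel.fst_apply, h₁, ProbabilityTheory.Kernel.const_apply]
  have hsnd : π.map Prod.snd = ν := by
    rw [hπ, ← ProbabilityTheory.Kernel.snd_apply, h₂, ProbabilityTheory.Kernel.const_apply]
  have Lμ := memLp_two_id_of_lintegral hμ2
  have Lν := memLp_two_id_of_lintegral hν2
  have Mμ (i : Fin n) : MemLp (fun x : EuclideanSpace ℝ (Fin n) => x i) 2 μ :=
    (EuclideanSpace.proj (𝕜 := ℝ) i).comp_memLp' Lμ
  have Mν (i : Fin n) : MemLp (fun x : EuclideanSpace ℝ (Fin n) => x i) 2 ν :=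
    (EuclideanSpace.proj (𝕜 := ℝ) i).comp_memLp' Lν
  have key := hκ () hμ hν Mμ Mν
  simp only [ProbabilityTheory.Kernel.const_apply] at key
  have hmean (i : Fin n) : ∫ x : EuclideanSpace ℝ (Fin n), x i ∂μ = 0 := by
    have := (EuclideanSpace.proj (𝕜 := ℝ) i).integral_comp_comm (Lμ.integrable one_le_two)
    simpa [hcent] using! this
  refine (iInf_le _ ⟨π, inferInstance, hfst, hsnd⟩).trans ?_
  have I₁ (i : Fin n) :
      MemLp (fun p : EuclideanSpace ℝ (Fin n) × EuclideanSpace ℝ (Fin n) => p.1 i) 2 π :=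
    MemLp.comp_of_map (f := Prod.fst) (hfst.symm ▸ Mμ i) (by fun_prop)
  have I₂ (i : Fin n) :
      MemLp (fun p : EuclideanSpace ℝ (Fin n) × EuclideanSpace ℝ (Fin n) => p.2 i) 2 π :=
    MemLp.comp_of_map (f := Prod.snd) (hsnd.symm ▸ Mν i) (by fun_prop)
  have J (i : Fin n) : Integrable (fun p : EuclideanSpace ℝ (Fin n) × EuclideanSpace ℝ (Fin n) =>
      (p.1 i - p.2 i) ^ 2) π := ((I₁ i).sub (I₂ i)).integrable_sq
  have E₁ (i : Fin n) : ∫ p, p.1 i ^ 2 ∂π = ∫ x, x i ^ 2 ∂μ := by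
    conv_rhs => rw [← hfst, integral_map (by fun_prop) (by fun_prop)]
  have E₂ (i : Fin n) : ∫ p, p.2 i ^ 2 ∂π = ∫ x, x i ^ 2 ∂ν := by
    conv_rhs => rw [← hsnd, integral_map (by fun_prop) (by fun_prop)]
  have expand (i : Fin n) : ∫ p, (p.1 i - p.2 i) ^ 2 ∂π =
      2 * ((∫ x, x i ^ 2 ∂μ) / 2 + (∫ x, x i ^ 2 ∂ν) / 2 - ∫ p, p.1 i * p.2 i ∂π) := by
    have e (p : EuclideanSpace ℝ (Fin n) × EuclideanSpace ℝ (Fin n)) :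
        (p.1 i - p.2 i) ^ 2 = p.1 i ^ 2 + p.2 i ^ 2 - 2 * (p.1 i * p.2 i) := by ring
    have hi : Integrable (fun p : EuclideanSpace ℝ (Fin n) × EuclideanSpace ℝ (Fin n) =>
      p.1 i * p.2 i) π := (I₁ i).integrable_mul (I₂ i)
    simp_rw [e]
    rw [integral_sub (f := fun p => p.1 i ^ 2 + p.2 i ^ 2)
      ((I₁ i).integrable_sq.add (I₂ i).integrable_sq) (hi.const_mul 2),
      integral_add (I₁ i).integrable_sq (I₂ i).integrable_sq, integral_const_mul, E₁, E₂]
    ring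
  calc ∫⁻ p, ‖p.1 - p.2‖₊ ^ 2 ∂π
      = ∫⁻ p, ENNReal.ofReal (∑ i, (p.1 i - p.2 i) ^ 2) ∂π := by
        refine lintegral_congr fun p => ?_
        have : ∑ i, (p.1 i - p.2 i) ^ 2 = ‖p.1 - p.2‖ ^ 2 := by
          simp [EuclideanSpace.norm_sq_eq]
        rw [this, ENNReal.ofReal_pow (norm_nonneg _), ofReal_norm, enorm_eq_nnnorm]
    _ = ENNReal.ofReal (∑ i, ∫ p, (p.1 i - p.2 i) ^ 2 ∂π) := by
        rw [← integral_finsetSum _ fun i _ => J i, ofReal_integral_eq_lintegral_ofReal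
          (integrable_finsetSum _ fun i _ => J i) (.of_forall fun p => by positivity)]
    _ ≤ ENNReal.ofReal (2 * (InformationTheory.klDiv μ (stdGaussian n)).toReal +
          2 * (InformationTheory.klDiv ν (stdGaussian n)).toReal) := by
        refine ENNReal.ofReal_le_ofReal ?_
        simp only [hmean, zero_mul, sub_zero] at key
        simp_rw [expand, ← Finset.mul_sum]
        linarith
    _ = _ := by
        rw [ENNReal.ofReal_add (by positivity) (by positivity), ENNReal.ofReal_mul zero_le_two,
          ENNReal.ofReal_mul zero_le_two, ENNReal.ofReal_toReal hμ, ENNReal.ofReal_toReal hν]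
        simp
end

section
/- Let n ≥ 1 and let f, g : ℝⁿ → ℝ be Borel measurable functions such that the function x ↦ x·e^{-f(x)} is Lebesgue integrable with ∫_{ℝⁿ} x e^{-f(x)} dx = 0, and such that f(x) + g(y) ≥ ⟨x, y⟩ for all x, y ∈ ℝⁿ. Then (∫_{ℝⁿ} e^{-f(x)} dx)·(∫_{ℝⁿ} e^{-g(y)} dy) ≤ (2π)ⁿ, where the integrals are taken with values in [0, ∞]. -/
open MeasureTheory
open scoped RealInnerProductSpace

section OneDimensional

open Set

/-- The one-dimensional Brunn–Minkowski inequality, for midpoints of compact sets. -/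
lemma volume_add_volume_le_of_isCompact {K L C : Set ℝ} (hK : IsCompact K) (hL : IsCompact L)
    (hK0 : K.Nonempty) (hL0 : L.Nonempty) (hC : ∀ a ∈ K, ∀ b ∈ L, (a + b) / 2 ∈ C) :
    volume K + volume L ≤ 2 * volume C := by
  obtain ⟨a, haK, ha⟩ := hK.exists_isGreatest hK0
  obtain ⟨b, hbL, hb⟩ := hL.exists_isLeast hL0
  have key : ∀ (S : Set ℝ) (c : ℝ),
      volume ((fun x : ℝ => 2 * x) ⁻¹' ((fun x => x + c) ⁻¹' S)) = 2⁻¹ * volume S := by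
    intro S c
    rw [Real.volume_preimage_mul_left (by norm_num), measure_preimage_add_right,
      abs_of_pos (by norm_num), ENNReal.ofReal_inv_of_pos (by norm_num), ENNReal.ofReal_ofNat]
  set T₁ := (fun x : ℝ => 2 * x) ⁻¹' ((fun x => x + -b) ⁻¹' K)
  set T₂ := (fun x : ℝ => 2 * x) ⁻¹' ((fun x => x + -a) ⁻¹' L)
  have hT₂m : MeasurableSet T₂ :=
    ((hL.measurableSet).preimage (by fun_prop)).preimage (by fun_prop)
  have hsub : T₁ ∪ T₂ ⊆ C := by
    rintro x (hx | hx)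
    · convert hC _ hx _ hbL using 1; ring
    · convert hC _ haK _ hx using 1; ring
  have hdisj : AEDisjoint volume T₁ T₂ := by
    refine measure_mono_null (t := {(a + b) / 2}) ?_ (by simp)
    rintro x ⟨h₁, h₂⟩
    have h₁' := ha h₁
    have h₂' := hb h₂
    rw [mem_singleton_iff]
    linarith
  have h := measure_mono (μ := volume) hsub
  rw [measure_union₀ hT₂m.nullMeasurableSet hdisj, key, key, ← mul_add] at h
  calc volume K + volume L = 2 * (2⁻¹ * (volume K + volume L)) := by
        rw [← mul_assoc, ENNReal.mul_inv_cancel (by norm_num) (by norm_num), one_mul]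
    _ ≤ 2 * volume C := by gcongr

/-- The one-dimensional Brunn–Minkowski inequality, for midpoints. -/
lemma volume_add_volume_le {A B C : Set ℝ} (hA : MeasurableSet A) (hB : MeasurableSet B)
    (hA0 : A.Nonempty) (hB0 : B.Nonempty) (hC : ∀ a ∈ A, ∀ b ∈ B, (a + b) / 2 ∈ C) :
    volume A + volume B ≤ 2 * volume C := by
  obtain ⟨a, ha⟩ := hA0
  obtain ⟨b, hb⟩ := hB0
  rw [hA.measure_eq_iSup_isCompact, hB.measure_eq_iSup_isCompact]
  simp only [iSup_and']
  refine ENNReal.biSup_add_biSup_le' (p := fun K => K ⊆ A ∧ IsCompact K)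
    (q := fun K => K ⊆ B ∧ IsCompact K) ⟨∅, by simp⟩ ⟨∅, by simp⟩ ?_
  rintro K ⟨hKA, hK⟩ L ⟨hLB, hL⟩
  refine le_trans (add_le_add (measure_mono (subset_insert a K)) (measure_mono (subset_insert b L)))
    (volume_add_volume_le_of_isCompact (hK.insert a) (hL.insert b) ⟨a, by simp⟩ ⟨b, by simp⟩ ?_)
  exact fun x hx y hy => hC x (insert_subset ha hKA hx) y (insert_subset hb hLB hy)

/-- The additive form of the Prékopa–Leindler inequality on `ℝ` for functions of supremum `1`. -/
lemma lintegral_add_lintegral_le_of_sup_eq_one {f g h : ℝ → ℝ} (hf : Measurable f)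
    (hg : Measurable g) (hh : Measurable h) (hf0 : 0 ≤ f) (hg0 : 0 ≤ g) (hh0 : 0 ≤ h)
    (hf1 : ∀ x, f x ≤ 1) (hg1 : ∀ x, g x ≤ 1) (hfs : ∀ t < 1, ∃ x, t < f x)
    (hgs : ∀ t < 1, ∃ x, t < g x) (hfg : ∀ x y, f x * g y ≤ h ((x + y) / 2) ^ 2) :
    (∫⁻ x, ENNReal.ofReal (f x)) + ∫⁻ x, ENNReal.ofReal (g x) ≤
      2 * ∫⁻ x, ENNReal.ofReal (h x) := by
  rw [lintegral_eq_lintegral_meas_lt volume (.of_forall hf0) hf.aemeasurable,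
    lintegral_eq_lintegral_meas_lt volume (.of_forall hg0) hg.aemeasurable,
    lintegral_eq_lintegral_meas_lt volume (.of_forall hh0) hh.aemeasurable,
    ← lintegral_const_mul' _ _ (by norm_num), ← lintegral_add_left]
  · refine setLIntegral_mono' measurableSet_Ioi fun t ht => ?_
    rw [mem_Ioi] at ht
    rcases lt_or_ge t 1 with h1 | h1
    · refine volume_add_volume_le (measurableSet_lt measurable_const hf)
        (measurableSet_lt measurable_const hg) (hfs t h1) (hgs t h1) fun x hx y hy => ?_
      refine lt_of_pow_lt_pow_left₀ 2 (hh0 _) (lt_of_lt_of_le ?_ (hfg x y))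
      rw [sq]
      exact mul_lt_mul'' hx hy ht.le ht.le
    · have e : ∀ u : ℝ → ℝ, (∀ x, u x ≤ 1) → {x | t < u x} = ∅ := fun u hu => by
        ext x; simpa using (hu x).trans h1
      simp [e f hf1, e g hg1]
  · exact Antitone.measurable fun s t hst => measure_mono fun x hx => lt_of_le_of_lt hst hx

lemma ENNReal.mul_le_sq_of_add_le_two_mul {a b c : ENNReal} (h : a + b ≤ 2 * c) :
    a * b ≤ c ^ 2 := by
  have key : ∀ a b : ENNReal, a ≤ b → 4 * (a * b) ≤ (a + b) ^ 2 := by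
    intro a b hab
    obtain ⟨d, rfl⟩ := exists_add_of_le hab
    calc 4 * (a * (a + d)) ≤ 4 * (a * (a + d)) + d ^ 2 := le_self_add
      _ = _ := by ring
  have h4 : 4 * (a * b) ≤ 4 * c ^ 2 := by
    calc 4 * (a * b) ≤ (a + b) ^ 2 := by
          rcases le_total a b with hab | hab
          · exact key a b hab
          · rw [mul_comm a, add_comm a]; exact key b a hab
      _ ≤ (2 * c) ^ 2 := by gcongr
      _ = _ := by ring
  exact (ENNReal.mul_le_mul_iff_right (by norm_num) (by norm_num)).1 h4

/-- The Prékopa–Leindler inequality on `ℝ` for bounded functions. -/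
lemma lintegral_mul_lintegral_le_sq_of_bounded {f g h : ℝ → ℝ} (hf : Measurable f)
    (hg : Measurable g) (hh : Measurable h) (hf0 : 0 ≤ f) (hg0 : 0 ≤ g) (hh0 : 0 ≤ h)
    (hfb : BddAbove (range f)) (hgb : BddAbove (range g))
    (hfg : ∀ x y, f x * g y ≤ h ((x + y) / 2) ^ 2) :
    (∫⁻ x, ENNReal.ofReal (f x)) * ∫⁻ x, ENNReal.ofReal (g x) ≤
      (∫⁻ x, ENNReal.ofReal (h x)) ^ 2 := by
  set a := ⨆ x, f x
  set b := ⨆ x, g x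
  have hfa : ∀ x, f x ≤ a := le_ciSup hfb
  have hgb' : ∀ x, g x ≤ b := le_ciSup hgb
  rcases (hf0 0).trans (hfa 0) |>.eq_or_lt with ha | ha
  · have : ∀ x, ENNReal.ofReal (f x) = 0 := fun x =>
      ENNReal.ofReal_eq_zero.2 ((hfa x).trans ha.symm.le)
    simp [this]
  rcases (hg0 0).trans (hgb' 0) |>.eq_or_lt with hb | hb
  · have : ∀ x, ENNReal.ofReal (g x) = 0 := fun x =>
      ENNReal.ofReal_eq_zero.2 ((hgb' x).trans hb.symm.le)
    simp [this]
  have ha : 0 < a := ha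
  have hb : 0 < b := hb
  have hab : 0 < √(a * b) := by positivity
  have main := ENNReal.mul_le_sq_of_add_le_two_mul
    (lintegral_add_lintegral_le_of_sup_eq_one (f := fun x => a⁻¹ * f x)
    (g := fun x => b⁻¹ * g x) (h := fun x => (√(a * b))⁻¹ * h x)
    (by fun_prop) (by fun_prop) (by fun_prop) (fun x => mul_nonneg (by positivity) (hf0 x))
    (fun x => mul_nonneg (by positivity) (hg0 x)) (fun x => mul_nonneg (by positivity) (hh0 x))
    (fun x => (inv_mul_le_one₀ ha).2 (hfa x)) (fun x => (inv_mul_le_one₀ hb).2 (hgb' x))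
    (fun t ht => by
      obtain ⟨x, hx⟩ := exists_lt_of_lt_ciSup (show a * t < ⨆ x, f x from
        mul_lt_of_lt_one_right ha ht)
      exact ⟨x, by rwa [lt_inv_mul_iff₀ ha]⟩)
    (fun t ht => by
      obtain ⟨x, hx⟩ := exists_lt_of_lt_ciSup (show b * t < ⨆ x, g x from
        mul_lt_of_lt_one_right hb ht)
      exact ⟨x, by rwa [lt_inv_mul_iff₀ hb]⟩)
    (fun x y => by
      rw [mul_pow, inv_pow, Real.sq_sqrt (by positivity), mul_inv]
      calc a⁻¹ * f x * (b⁻¹ * g y) = a⁻¹ * b⁻¹ * (f x * g y) := by ring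
        _ ≤ _ := by gcongr; exact hfg x y))
  simp only [ENNReal.ofReal_mul (inv_nonneg.2 ha.le), ENNReal.ofReal_mul (inv_nonneg.2 hb.le),
    ENNReal.ofReal_mul (inv_nonneg.2 hab.le)] at main
  rw [lintegral_const_mul' _ _ (by simp), lintegral_const_mul' _ _ (by simp),
    lintegral_const_mul' _ _ (by simp), mul_mul_mul_comm, mul_pow,
    ← ENNReal.ofReal_pow (by positivity), ← ENNReal.ofReal_mul (by positivity), inv_pow,
    Real.sq_sqrt (by positivity), mul_inv] at main
  exact (ENNReal.mul_le_mul_iff_right (by simp; positivity) (by simp)).1 main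

lemma lintegral_eq_iSup_min {α : Type*} [MeasurableSpace α] (μ : Measure α) {f : α → ENNReal}
    (hf : Measurable f) : ∫⁻ x, f x ∂μ = ⨆ k : ℕ, ∫⁻ x, min (f x) k ∂μ := by
  rw [← lintegral_iSup (f := fun (k : ℕ) x => min (f x) k) (fun k => by fun_prop)
    (fun i j hij x => min_le_min_left _ (by exact_mod_cast hij))]
  refine lintegral_congr fun x => ?_
  rw [← inf_iSup_eq, ENNReal.iSup_natCast, inf_top_eq]

/-- The Prékopa–Leindler inequality on `ℝ`. -/
lemma lintegral_mul_lintegral_le_sq {f g : ℝ → ENNReal} {h : ℝ → ℝ} (hf : Measurable f)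
    (hg : Measurable g) (hh : Measurable h) (hh0 : 0 ≤ h)
    (hfg : ∀ x y, f x * g y ≤ ENNReal.ofReal (h ((x + y) / 2) ^ 2)) :
    (∫⁻ x, f x) * ∫⁻ x, g x ≤ (∫⁻ x, ENNReal.ofReal (h x)) ^ 2 := by
  have hmin : ∀ (a : ENNReal) (k : ℕ), min a k ≠ ⊤ := fun a k =>
    ((min_le_right a k).trans_lt (ENNReal.natCast_lt_top k)).ne
  have hle : ∀ (a : ENNReal) (k : ℕ), (min a k).toReal ≤ k := fun a k => by
    simpa using ENNReal.toReal_mono (by simp) (min_le_right a (k : ENNReal))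
  rw [lintegral_eq_iSup_min volume hf, lintegral_eq_iSup_min volume hg]
  simp_rw [ENNReal.iSup_mul, ENNReal.mul_iSup]
  refine iSup₂_le fun i j => ?_
  have := lintegral_mul_lintegral_le_sq_of_bounded (f := fun x => (min (f x) i).toReal)
    (g := fun x => (min (g x) j).toReal) (by fun_prop) (by fun_prop) hh
    (fun _ => ENNReal.toReal_nonneg) (fun _ => ENNReal.toReal_nonneg) hh0
    ⟨i, by rintro _ ⟨x, rfl⟩; exact hle _ _⟩ ⟨j, by rintro _ ⟨x, rfl⟩; exact hle _ _⟩
    fun x y => by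
      rw [← ENNReal.toReal_mul]
      refine ENNReal.toReal_le_of_le_ofReal (by positivity) (le_trans ?_ (hfg x y))
      gcongr <;> exact min_le_left _ _
  simpa only [ENNReal.ofReal_toReal (hmin _ _)] using this

lemma lintegral_Ioi_eq_lintegral_exp (φ : ℝ → ENNReal) :
    ∫⁻ s in Ioi 0, φ s = ∫⁻ u, ENNReal.ofReal (Real.exp u) * φ (Real.exp u) := by
  have := lintegral_image_eq_lintegral_abs_deriv_mul (s := univ) (f := Real.exp) (f' := Real.exp)
    MeasurableSet.univ (fun x _ => (Real.hasDerivAt_exp x).hasDerivWithinAt)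
    Real.exp_injective.injOn φ
  rw [image_univ, Real.range_exp] at this
  simpa [abs_of_pos (Real.exp_pos _)] using this

/-- The functional Santaló inequality on the half-line. -/
lemma lintegral_Ioi_mul_lintegral_Ioi_le {φ ψ : ℝ → ENNReal} (hφ : Measurable φ)
    (hψ : Measurable ψ)
    (h : ∀ s > 0, ∀ t > 0, φ s * ψ t ≤ ENNReal.ofReal (Real.exp (-(s * t)))) :
    (∫⁻ s in Ioi 0, φ s) * ∫⁻ t in Ioi 0, ψ t ≤ ENNReal.ofReal (Real.pi / 2) := by
  have hgauss : ∫⁻ u, ENNReal.ofReal (Real.exp u * Real.exp (-(1 / 2) * Real.exp u ^ 2)) =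
      ENNReal.ofReal (√(Real.pi / 2)) := by
    simp_rw [ENNReal.ofReal_mul (Real.exp_pos _).le]
    rw [← lintegral_Ioi_eq_lintegral_exp
      (fun r => ENNReal.ofReal (Real.exp (-(1 / 2) * r ^ 2))),
      ← ofReal_integral_eq_lintegral_ofReal
        ((integrable_exp_neg_mul_sq (by norm_num)).integrableOn)
        (.of_forall fun x => (Real.exp_pos _).le), integral_gaussian_Ioi]
    congr 1
    rw [show Real.pi / (1 / 2) = 2 ^ 2 * (Real.pi / 2) by ring,
      Real.sqrt_mul (by positivity), Real.sqrt_sq (by norm_num)]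
    ring
  rw [lintegral_Ioi_eq_lintegral_exp, lintegral_Ioi_eq_lintegral_exp]
  refine (lintegral_mul_lintegral_le_sq
    (h := fun u => Real.exp u * Real.exp (-(1 / 2) * Real.exp u ^ 2))
    (by fun_prop) (by fun_prop) (by fun_prop) (fun u => by positivity) fun x y => ?_).trans ?_
  · calc _ = ENNReal.ofReal (Real.exp x) * ENNReal.ofReal (Real.exp y) *
          (φ (Real.exp x) * ψ (Real.exp y)) := by ring
      _ ≤ ENNReal.ofReal (Real.exp x) * ENNReal.ofReal (Real.exp y) *
          ENNReal.ofReal (Real.exp (-(Real.exp x * Real.exp y))) := by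
        gcongr
        exact h _ (Real.exp_pos _) _ (Real.exp_pos _)
      _ = _ := by
        rw [← ENNReal.ofReal_mul (by positivity), ← ENNReal.ofReal_mul (by positivity)]
        simp only [← Real.exp_add, ← Real.exp_nat_mul]
        congr 2
        push_cast
        rw [show (2 : ℝ) * ((x + y) / 2) = x + y by ring]
        ring
  · rw [hgauss, ← ENNReal.ofReal_pow (by positivity), Real.sq_sqrt (by positivity)]

end OneDimensional

section Centering

open Set

/-- A centered exponential tilt does not decrease the total mass. -/
lemma measure_univ_le_lintegral_exp {α : Type*} [MeasurableSpace α] {ν : Measure α}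
    [IsFiniteMeasure ν] {l : α → ℝ} (hl : Integrable l ν) (h0 : ∫ x, l x ∂ν = 0) :
    ν univ ≤ ∫⁻ x, ENNReal.ofReal (Real.exp (l x)) ∂ν := by
  by_cases hexp : Integrable (fun x => Real.exp (l x)) ν
  · rw [← ofReal_integral_eq_lintegral_ofReal hexp (.of_forall fun x => (Real.exp_pos _).le),
      ← ofReal_measureReal]
    refine ENNReal.ofReal_le_ofReal ?_
    calc ν.real univ = ∫ x, (l x + 1) ∂ν := by
          rw [integral_add hl (integrable_const _), h0]; simp
      _ ≤ ∫ x, Real.exp (l x) ∂ν :=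
          integral_mono (hl.add (integrable_const _)) hexp fun x => Real.add_one_le_exp _
  · have : ∫⁻ x, ENNReal.ofReal (Real.exp (l x)) ∂ν = ⊤ := by
      by_contra hne
      refine hexp ⟨Real.continuous_exp.comp_aestronglyMeasurable hl.1, ?_⟩
      rw [hasFiniteIntegral_iff_ofReal (.of_forall fun x => (Real.exp_pos _).le)]
      exact lt_top_iff_ne_top.2 hne
    simp [this]

/-- An atomless finite measure on `ℝ` with bounded support has a median. -/
lemma exists_measure_Ioi_eq_measure_Iio (ρ : Measure ℝ) [IsFiniteMeasure ρ]
    (hρ : ∀ c, ρ {c} = 0) {R : ℝ} (hR0 : 0 ≤ R) (hR : ρ {t | R < |t|} = 0) :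
    ∃ c, ρ (Ioi c) = ρ (Iio c) := by
  have : NullSingletonClass ρ := ⟨hρ⟩
  set I : ℝ → ℝ := fun c => ∫ _ in -R..c, (1 : ℝ) ∂ρ with hI
  have hcont : Continuous I :=
    intervalIntegral.continuous_primitive (fun a b => intervalIntegrable_const) _
  have hIic : ρ (Iic (-R)) = 0 := by
    rw [← measure_congr (Iio_ae_eq_Iic (a := -R))]
    refine measure_mono_null (fun t ht => show R < |t| from ?_) hR
    rw [mem_Iio] at ht
    exact lt_abs.2 (Or.inr (by linarith))
  have hIoi : ρ (Ioi R) = 0 :=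
    measure_mono_null (fun t ht => show R < |t| from lt_abs.2 (Or.inl ht)) hR
  have hval : ∀ c, -R ≤ c → I c = ρ.real (Iic c) := by
    intro c hc
    simp only [hI, intervalIntegral.integral_const', Ioc_eq_empty_of_le hc, measureReal_empty,
      sub_zero, smul_eq_mul, mul_one]
    rw [← Iic_union_Ioc_eq_Iic hc, measureReal_union₀ measurableSet_Ioc.nullMeasurableSet
      (Iic_disjoint_Ioc le_rfl).aedisjoint, Measure.real, Measure.real, hIic]
    simp
  have hcompl : ∀ c, ρ.real (Iic c) + ρ.real (Ioi c) = ρ.real univ := fun c => by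
    rw [← compl_Iic, measureReal_add_measureReal_compl measurableSet_Iic]
  have hIR : I R = ρ.real univ := by
    rw [hval R (by linarith), ← hcompl R]
    simp [Measure.real, hIoi]
  have hIR' : I (-R) = 0 := by simp [hI]
  obtain ⟨c, hc, hc'⟩ := intermediate_value_Icc (by linarith : -R ≤ R) hcont.continuousOn
    (show ρ.real univ / 2 ∈ Icc (I (-R)) (I R) by
      rw [hIR, hIR']; constructor <;> linarith [measureReal_nonneg (μ := ρ) (s := univ)])
  rw [hval c hc.1] at hc'
  refine ⟨c, ?_⟩
  rw [measure_congr (Iio_ae_eq_Iic (a := c)), ← measureReal_eq_measureReal_iff]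
  linarith [hcompl c]

variable {n : ℕ}

/-- If the barycenter of a finite measure lies on a line through `(z, c)` with direction `(v, 1)`,
then exponential tilts transverse to that line do not decrease the mass. -/
lemma measure_univ_le_lintegral_exp_dotProduct (ν : Measure ((Fin n → ℝ) × ℝ)) [IsFiniteMeasure ν]
    {z v : Fin n → ℝ} {c : ℝ} (h₁ : Integrable (fun p => p.1) ν)
    (h₂ : Integrable (fun p => p.2 - c) ν)
    (h : ∫ p, p.1 ∂ν = ν.real univ • z + (∫ p, (p.2 - c) ∂ν) • v) (w : Fin n → ℝ) :
    ν univ ≤ ∫⁻ p, ENNReal.ofReal (Real.exp ((p.1 - z - (p.2 - c) • v) ⬝ᵥ w)) ∂ν := by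
  let L : (Fin n → ℝ) →L[ℝ] ℝ := LinearMap.toContinuousLinearMap
    { toFun := fun u => u ⬝ᵥ w
      map_add' := fun _ _ => add_dotProduct _ _ _
      map_smul' := fun _ _ => smul_dotProduct _ _ _ }
  have h₁' : Integrable (fun p => p.1 - z) ν := h₁.sub (integrable_const z)
  have h₃ : Integrable (fun p => p.1 - z - (p.2 - c) • v) ν := h₁'.sub (h₂.smul_const v)
  refine measure_univ_le_lintegral_exp (L.integrable_comp h₃) ?_
  change ∫ p, L (p.1 - z - (p.2 - c) • v) ∂ν = 0
  rw [L.integral_comp_comm h₃, integral_sub h₁' (h₂.smul_const v),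
    integral_sub h₁ (integrable_const z), integral_smul_const, h, integral_const]
  simp

/-- Given a nonzero finite measure of bounded support that does not charge horizontal hyperplanes,
some horizontal hyperplane halves it, and the barycenters of both halves lie on a common
transverse line. -/
lemma exists_halving_center (ν : Measure ((Fin n → ℝ) × ℝ)) [IsFiniteMeasure ν] (hν : ν ≠ 0)
    (hslice : ∀ c : ℝ, ν {p | p.2 = c} = 0) {R : ℝ} (hR0 : 0 ≤ R) (hR : ν {p | R < ‖p‖} = 0) :
    ∃ (z v : Fin n → ℝ) (c : ℝ), ν {p | 0 < p.2 - c} = ν {p | p.2 - c < 0} ∧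
      (∀ w, ν {p | 0 < p.2 - c} ≤ ∫⁻ p in {p | 0 < p.2 - c},
        ENNReal.ofReal (Real.exp ((p.1 - z - (p.2 - c) • v) ⬝ᵥ w)) ∂ν) ∧
      (∀ w, ν {p | p.2 - c < 0} ≤ ∫⁻ p in {p | p.2 - c < 0},
        ENNReal.ofReal (Real.exp ((p.1 - z - (p.2 - c) • v) ⬝ᵥ w)) ∂ν) := by
  obtain ⟨c, hc⟩ : ∃ c, ν {p | 0 < p.2 - c} = ν {p | p.2 - c < 0} := by
    obtain ⟨c, hc⟩ := exists_measure_Ioi_eq_measure_Iio (ν.map Prod.snd) (fun c => by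
      rw [Measure.map_apply measurable_snd (measurableSet_singleton c)]
      exact hslice c) hR0 (by
      rw [Measure.map_apply measurable_snd (measurableSet_lt (by fun_prop) (by fun_prop))]
      exact measure_mono_null (fun p hp => lt_of_lt_of_le hp (norm_snd_le p)) hR)
    rw [Measure.map_apply measurable_snd measurableSet_Ioi,
      Measure.map_apply measurable_snd measurableSet_Iio] at hc
    refine ⟨c, ?_⟩
    simp only [sub_pos, sub_neg]
    exact hc
  set S := {p : (Fin n → ℝ) × ℝ | 0 < p.2 - c}
  set T := {p : (Fin n → ℝ) × ℝ | p.2 - c < 0}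
  have hSm : MeasurableSet S := measurableSet_lt (by fun_prop) (by fun_prop)
  have hTm : MeasurableSet T := measurableSet_lt (by fun_prop) (by fun_prop)
  have hbound : ∀ᵐ p ∂ν, ‖p‖ ≤ R := by
    simpa [ae_iff] using hR
  have h₁ : Integrable (fun p => p.1) ν :=
    .of_bound (by fun_prop) R (hbound.mono fun p hp => (norm_fst_le p).trans hp)
  have h₂ : Integrable (fun p => p.2 - c) ν :=
    (Integrable.of_bound (by fun_prop) R
      (hbound.mono fun p hp => (norm_snd_le p).trans hp)).sub (integrable_const c)
  have hSpos : ν S ≠ 0 := by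
    intro h0
    refine hν (Measure.measure_univ_eq_zero.1 ?_)
    refine measure_mono_null (t := S ∪ T ∪ {p | p.2 = c}) (fun p _ => ?_) ?_
    · rcases lt_trichotomy (p.2 - c) 0 with h | h | h
      · exact Or.inl (Or.inr h)
      · exact Or.inr (sub_eq_zero.1 h)
      · exact Or.inl (Or.inl h)
    · simp [measure_union_null_iff, h0, ← hc, hslice c]
  set m := ν.real S
  have hm : m ≠ 0 := by simpa [m, Measure.real, ENNReal.toReal_eq_zero_iff] using hSpos
  have hm' : ν.real T = m := by simp [m, Measure.real, hc]
  set a := ∫ p in S, (p.2 - c) ∂ν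
  set b := ∫ p in T, (p.2 - c) ∂ν
  have ha : 0 < a := by
    refine (setIntegral_pos_iff_support_of_nonneg_ae ?_ h₂.integrableOn).2 ?_
    · exact (ae_restrict_mem hSm).mono fun p hp => le_of_lt hp
    · have : S ⊆ Function.support fun p => p.2 - c := fun p hp => ne_of_gt hp
      rw [inter_eq_right.2 this]
      exact pos_iff_ne_zero.2 hSpos
  have hb : b ≤ 0 := setIntegral_nonpos hTm fun p hp => le_of_lt hp
  have hab : a - b ≠ 0 := by linarith
  set q := ∫ p in S, p.1 ∂ν
  set r := ∫ p in T, p.1 ∂ν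
  set v := (a - b)⁻¹ • (q - r) with hv
  set z := m⁻¹ • (q - a • v) with hz
  have hqz : q = m • z + a • v := by
    rw [hz, smul_inv_smul₀ hm]; simp
  have hrz : r = m • z + b • v := by
    have : (a - b) • v = q - r := by rw [hv, smul_inv_smul₀ hab]
    rw [sub_smul] at this
    calc r = q - (q - r) := by simp
      _ = _ := by rw [← this, hqz]; abel
  refine ⟨z, v, c, hc, fun w => ?_, fun w => ?_⟩
  · simpa only [Measure.restrict_apply MeasurableSet.univ, univ_inter] using
      measure_univ_le_lintegral_exp_dotProduct (ν.restrict S)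
        h₁.integrableOn h₂.integrableOn (by simpa using hqz) w
  · simpa only [Measure.restrict_apply MeasurableSet.univ, univ_inter] using
      measure_univ_le_lintegral_exp_dotProduct (ν.restrict T)
        h₁.integrableOn h₂.integrableOn (by simpa [hm'] using hrz) w

end Centering

section Induction

open Set

/-- The functional Santaló inequality in dimension `n`, with a weak form of the centering
hypothesis. -/
def CenteredSantalo (n : ℕ) : Prop :=
  ∀ F G : (Fin n → ℝ) → ENNReal, Measurable F → Measurable G →
    (∀ w, ∫⁻ x, F x ≤ ∫⁻ x, ENNReal.ofReal (Real.exp (x ⬝ᵥ w)) * F x) →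
    (∀ x y, F x * G y ≤ ENNReal.ofReal (Real.exp (-(x ⬝ᵥ y)))) →
    (∫⁻ x, F x) * ∫⁻ y, G y ≤ ENNReal.ofReal ((2 * Real.pi) ^ n)

lemma centeredSantalo_zero : CenteredSantalo 0 := by
  intro F G _ _ _ h
  have := h 0 0
  have e : ∀ F : (Fin 0 → ℝ) → ENNReal, ∫⁻ x, F x = F 0 := fun F => by
    rw [lintegral_unique]; simp [volume_pi]; congr 1
  simpa [e] using this

variable {n : ℕ}

lemma CenteredSantalo.halfSpace (hn : CenteredSantalo n) {F G : (Fin n → ℝ) × ℝ → ENNReal}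
    (hF : Measurable F) (hG : Measurable G)
    (hcent : ∀ w, ∫⁻ y, ∫⁻ t in Ioi 0, G (y, t) ≤
      ∫⁻ y, ENNReal.ofReal (Real.exp (y ⬝ᵥ w)) * ∫⁻ t in Ioi 0, G (y, t))
    (hFG : ∀ x y, ∀ s > 0, ∀ t > 0,
      F (x, s) * G (y, t) ≤ ENNReal.ofReal (Real.exp (-(x ⬝ᵥ y + s * t)))) :
    (∫⁻ x, ∫⁻ s in Ioi 0, F (x, s)) * (∫⁻ y, ∫⁻ t in Ioi 0, G (y, t)) ≤
      ENNReal.ofReal (Real.pi / 2 * (2 * Real.pi) ^ n) := by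
  have hF' : Measurable fun x => ∫⁻ s in Ioi 0, F (x, s) := hF.lintegral_prod_right'
  have hG' : Measurable fun x => ∫⁻ s in Ioi 0, G (x, s) := hG.lintegral_prod_right'
  have hpi : ENNReal.ofReal (Real.pi / 2) ≠ 0 := by simp [Real.pi_pos]
  have := hn _ (fun x => (ENNReal.ofReal (Real.pi / 2))⁻¹ * ∫⁻ s in Ioi 0, F (x, s)) hG'
    (by fun_prop) hcent fun y x => ?_
  · rw [lintegral_const_mul _ hF', mul_left_comm, ENNReal.inv_mul_le_iff hpi (by simp),
      ← ENNReal.ofReal_mul (by positivity)] at this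
    rwa [mul_comm]
  · rw [mul_left_comm, ENNReal.inv_mul_le_iff hpi (by simp), mul_comm (lintegral _ _)]
    have key := lintegral_Ioi_mul_lintegral_Ioi_le
      (φ := fun s => ENNReal.ofReal (Real.exp (x ⬝ᵥ y)) * F (x, s)) (ψ := fun t => G (y, t))
      (by fun_prop) (by fun_prop) fun s hs t ht => by
        calc _ = ENNReal.ofReal (Real.exp (x ⬝ᵥ y)) * (F (x, s) * G (y, t)) := by ring
          _ ≤ ENNReal.ofReal (Real.exp (x ⬝ᵥ y)) *
              ENNReal.ofReal (Real.exp (-(x ⬝ᵥ y + s * t))) := by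
            gcongr; exact hFG x y s hs t ht
          _ = _ := by
            rw [← ENNReal.ofReal_mul (by positivity), ← Real.exp_add]
            congr 2; ring
    rw [lintegral_const_mul _ (by fun_prop), mul_assoc, mul_comm] at key
    calc _ = (∫⁻ s in Ioi 0, F (x, s)) * (∫⁻ t in Ioi 0, G (y, t)) *
          (ENNReal.ofReal (Real.exp (x ⬝ᵥ y)) * ENNReal.ofReal (Real.exp (-(x ⬝ᵥ y)))) := by
          rw [← ENNReal.ofReal_mul (by positivity), ← Real.exp_add]; simp
      _ ≤ ENNReal.ofReal (Real.pi / 2) * ENNReal.ofReal (Real.exp (-(x ⬝ᵥ y))) := by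
          rw [← mul_assoc]; gcongr
      _ = _ := by rw [dotProduct_comm]

lemma setLIntegral_Ioi_comp_neg {φ : ℝ → ENNReal} (hφ : Measurable φ) :
    ∫⁻ s in Ioi 0, φ (-s) = ∫⁻ s in Iio 0, φ s := by
  have := (Measure.measurePreserving_neg (volume : Measure ℝ)).setLIntegral_comp_preimage
    (measurableSet_Iio (a := 0)) hφ
  simpa using this

lemma lintegral_prod_eq_Ioi_add_Iio {F : (Fin n → ℝ) × ℝ → ENNReal} (hF : Measurable F) :
    ∫⁻ p, F p = (∫⁻ x, ∫⁻ s in Ioi 0, F (x, s)) + ∫⁻ x, ∫⁻ s in Ioi 0, F (x, -s) := by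
  rw [Measure.volume_eq_prod, lintegral_prod _ hF.aemeasurable,
    ← lintegral_add_left hF.lintegral_prod_right']
  refine lintegral_congr fun x => ?_
  rw [setLIntegral_Ioi_comp_neg (φ := fun s => F (x, s)) (by fun_prop),
    ← lintegral_add_compl _ (measurableSet_Ioi (a := (0 : ℝ))), compl_Ioi,
    setLIntegral_congr Iio_ae_eq_Iic]

lemma CenteredSantalo.of_halving (hn : CenteredSantalo n) {F G : (Fin n → ℝ) × ℝ → ENNReal}
    (hF : Measurable F) (hG : Measurable G)
    (hhalf : ∫⁻ y, ∫⁻ t in Ioi 0, G (y, t) = ∫⁻ y, ∫⁻ t in Ioi 0, G (y, -t))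
    (hcent : ∀ w, ∫⁻ y, ∫⁻ t in Ioi 0, G (y, t) ≤
      ∫⁻ y, ENNReal.ofReal (Real.exp (y ⬝ᵥ w)) * ∫⁻ t in Ioi 0, G (y, t))
    (hcent' : ∀ w, ∫⁻ y, ∫⁻ t in Ioi 0, G (y, -t) ≤
      ∫⁻ y, ENNReal.ofReal (Real.exp (y ⬝ᵥ w)) * ∫⁻ t in Ioi 0, G (y, -t))
    (hFG : ∀ x y s t,
      F (x, s) * G (y, t) ≤ ENNReal.ofReal (Real.exp (-(x ⬝ᵥ y + s * t)))) :
    (∫⁻ p, F p) * ∫⁻ q, G q ≤ ENNReal.ofReal ((2 * Real.pi) ^ (n + 1)) := by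
  have h₁ := hn.halfSpace hF hG hcent fun x y s _ t _ => hFG x y s t
  have h₂ := hn.halfSpace (F := fun p => F (p.1, -p.2)) (G := fun p => G (p.1, -p.2))
    (by fun_prop) (by fun_prop) hcent' fun x y s _ t _ => by simpa using hFG x y (-s) (-t)
  rw [lintegral_prod_eq_Ioi_add_Iio hF, lintegral_prod_eq_Ioi_add_Iio hG]
  simp only at h₂
  rw [← hhalf] at h₂ ⊢
  set m := ∫⁻ y, ∫⁻ t in Ioi 0, G (y, t)
  calc _ = 2 * ((∫⁻ x, ∫⁻ s in Ioi 0, F (x, s)) * m +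
        (∫⁻ x, ∫⁻ s in Ioi 0, F (x, -s)) * m) := by ring
    _ ≤ 2 * (ENNReal.ofReal (Real.pi / 2 * (2 * Real.pi) ^ n) +
        ENNReal.ofReal (Real.pi / 2 * (2 * Real.pi) ^ n)) := by gcongr
    _ = _ := by
      rw [← ENNReal.ofReal_add (by positivity) (by positivity), ← ENNReal.ofReal_ofNat,
        ← ENNReal.ofReal_mul (by norm_num)]
      congr 1; ring

lemma lintegral_lintegral_Ioi {f : (Fin n → ℝ) × ℝ → ENNReal} (hf : Measurable f) :
    ∫⁻ y, ∫⁻ t in Ioi 0, f (y, t) = ∫⁻ p in {p | 0 < p.2}, f p := by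
  have : {p : (Fin n → ℝ) × ℝ | 0 < p.2} = univ ×ˢ Ioi 0 := by ext; simp
  rw [this, Measure.volume_eq_prod, ← Measure.prod_restrict, Measure.restrict_univ,
    lintegral_prod _ hf.aemeasurable]

lemma lintegral_lintegral_Ioi_neg {f : (Fin n → ℝ) × ℝ → ENNReal} (hf : Measurable f) :
    ∫⁻ y, ∫⁻ t in Ioi 0, f (y, -t) = ∫⁻ p in {p | p.2 < 0}, f p := by
  have : {p : (Fin n → ℝ) × ℝ | p.2 < 0} = univ ×ˢ Iio 0 := by ext; simp
  rw [this, Measure.volume_eq_prod, ← Measure.prod_restrict, Measure.restrict_univ,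
    lintegral_prod _ hf.aemeasurable]
  exact lintegral_congr fun y =>
    setLIntegral_Ioi_comp_neg (φ := fun s => f (y, s)) (by fun_prop)

lemma measurable_dotProduct_const (w : Fin n → ℝ) : Measurable fun x : Fin n → ℝ => x ⬝ᵥ w :=
  (continuous_id.dotProduct continuous_const).measurable

lemma measurePreserving_shear (z v : Fin n → ℝ) (c : ℝ) :
    MeasurePreserving (fun p : (Fin n → ℝ) × ℝ => (z + p.1 + p.2 • v, c + p.2)) := by
  have h := (measurePreserving_add_left volume c).skew_product (μc := volume) (μd := volume)
    (g := fun (t : ℝ) (y : Fin n → ℝ) => z + y + t • v) (by fun_prop)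
    (.of_forall fun t => ((measurePreserving_add_right volume (t • v)).comp
      (measurePreserving_add_left volume z)).map_eq)
  exact (Measure.measurePreserving_swap.comp h).comp Measure.measurePreserving_swap

lemma measurePreserving_shear_dotProduct (v : Fin n → ℝ) :
    MeasurePreserving (fun p : (Fin n → ℝ) × ℝ => (p.1, p.2 - p.1 ⬝ᵥ v)) :=
  (MeasurePreserving.id volume).skew_product (μc := volume) (μd := volume)
    (g := fun (x : Fin n → ℝ) (s : ℝ) => s - x ⬝ᵥ v)
    (measurable_snd.sub ((measurable_dotProduct_const v).comp measurable_fst))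
    (.of_forall fun x => (measurePreserving_sub_right volume (x ⬝ᵥ v)).map_eq)

/-- A boundedly supported function on `ℝⁿ × ℝ` admits a center for which the Santaló inequality
holds. -/
lemma CenteredSantalo.exists_center (hn : CenteredSantalo n) {G : (Fin n → ℝ) × ℝ → ENNReal}
    (hG : Measurable G) (hGi : ∫⁻ p, G p ≠ ⊤) {R : ℝ} (hR0 : 0 ≤ R)
    (hR : ∀ p, R < ‖p‖ → G p = 0) :
    ∃ (z : Fin n → ℝ) (c : ℝ), ∀ F : (Fin n → ℝ) × ℝ → ENNReal, Measurable F →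
      (∀ x y s t, F (x, s) * G (z + y, c + t) ≤
        ENNReal.ofReal (Real.exp (-(x ⬝ᵥ y + s * t)))) →
      (∫⁻ p, F p) * ∫⁻ q, G q ≤ ENNReal.ofReal ((2 * Real.pi) ^ (n + 1)) := by
  rcases eq_or_ne (∫⁻ p, G p) 0 with h0 | h0
  · exact ⟨0, 0, fun F _ _ => by simp [h0]⟩
  set ν := (volume : Measure ((Fin n → ℝ) × ℝ)).withDensity G with hνdef
  have : IsFiniteMeasure ν := isFiniteMeasure_withDensity hGi
  have hν : ν ≠ 0 := by
    intro h
    apply h0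
    rw [← setLIntegral_univ, ← withDensity_apply _ MeasurableSet.univ, ← hνdef, h]
    simp
  have hslice : ∀ c : ℝ, ν {p | p.2 = c} = 0 := by
    intro c
    refine withDensity_absolutelyContinuous _ _ ?_
    have : {p : (Fin n → ℝ) × ℝ | p.2 = c} = univ ×ˢ {c} := by ext; simp
    rw [this, Measure.volume_eq_prod, Measure.prod_prod]
    simp
  have hνR : ν {p | R < ‖p‖} = 0 := by
    have hm : MeasurableSet {p : (Fin n → ℝ) × ℝ | R < ‖p‖} :=
      measurableSet_lt measurable_const measurable_norm
    rw [withDensity_apply _ hm, setLIntegral_congr_fun hm fun p hp => hR p hp]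
    simp
  obtain ⟨z, v, c, hhalf, hpos, hneg⟩ := exists_halving_center ν hν hslice hR0 hνR
  have hT := measurePreserving_shear z v c
  have hSm : MeasurableSet {p : (Fin n → ℝ) × ℝ | 0 < p.2 - c} :=
    measurableSet_lt (by fun_prop) (by fun_prop)
  have hTm : MeasurableSet {p : (Fin n → ℝ) × ℝ | p.2 - c < 0} :=
    measurableSet_lt (by fun_prop) (by fun_prop)
  have hmeas : ∀ w, Measurable fun p : (Fin n → ℝ) × ℝ =>
      ENNReal.ofReal (Real.exp ((p.1 - z - (p.2 - c) • v) ⬝ᵥ w)) := fun w => by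
    have : Measurable fun p : (Fin n → ℝ) × ℝ => (p.1 - z - (p.2 - c) • v) ⬝ᵥ w :=
      (measurable_dotProduct_const w).comp (by fun_prop)
    fun_prop
  have hexp : ∀ w : Fin n → ℝ, Measurable fun y : Fin n → ℝ =>
      ENNReal.ofReal (Real.exp (y ⬝ᵥ w)) := fun w => by
    have := measurable_dotProduct_const w
    fun_prop
  have hG' : Measurable fun p : (Fin n → ℝ) × ℝ => G (z + p.1 + p.2 • v, c + p.2) :=
    hG.comp hT.measurable
  have mass : ∀ A : Set ℝ, MeasurableSet {p : (Fin n → ℝ) × ℝ | p.2 - c ∈ A} →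
      ∫⁻ p in {p : (Fin n → ℝ) × ℝ | p.2 ∈ A}, G (z + p.1 + p.2 • v, c + p.2) =
        ν {p | p.2 - c ∈ A} := fun A hA => by
    rw [withDensity_apply _ hA, ← hT.setLIntegral_comp_preimage hA hG]
    simp
  have tilt : ∀ (A : Set ℝ) (w), MeasurableSet {p : (Fin n → ℝ) × ℝ | p.2 - c ∈ A} →
      ∫⁻ p in {p : (Fin n → ℝ) × ℝ | p.2 ∈ A},
        ENNReal.ofReal (Real.exp (p.1 ⬝ᵥ w)) * G (z + p.1 + p.2 • v, c + p.2) =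
        ∫⁻ p in {p | p.2 - c ∈ A},
          ENNReal.ofReal (Real.exp ((p.1 - z - (p.2 - c) • v) ⬝ᵥ w)) ∂ν := fun A w hA => by
    rw [restrict_withDensity hA, lintegral_withDensity_eq_lintegral_mul _ hG (hmeas w),
      ← hT.setLIntegral_comp_preimage hA (hG.mul (hmeas w))]
    simp only [Pi.mul_apply, preimage_ofPred_eq, add_sub_cancel_left]
    refine lintegral_congr fun p => ?_
    rw [mul_comm, add_assoc, add_sub_cancel_left, add_sub_cancel_right]
  have mass₁ := mass (Ioi 0) hSm
  have mass₂ := mass (Iio 0) hTm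
  have tilt₁ := fun w => tilt (Ioi 0) w hSm
  have tilt₂ := fun w => tilt (Iio 0) w hTm
  simp only [mem_Ioi, mem_Iio] at mass₁ mass₂ tilt₁ tilt₂
  refine ⟨z, c, fun F hF hFG => ?_⟩
  have hF' := measurePreserving_shear_dotProduct v
  rw [← hF'.lintegral_comp hF, ← hT.lintegral_comp hG]
  refine hn.of_halving (hF.comp hF'.measurable) hG' ?_ (fun w => ?_) (fun w => ?_) ?_
  · rw [lintegral_lintegral_Ioi hG', lintegral_lintegral_Ioi_neg hG', mass₁, mass₂, hhalf]
  · have e := lintegral_lintegral_Ioi (((hexp w).comp measurable_fst).mul hG')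
    simp only [Function.comp_apply, Pi.mul_apply] at e
    simp_rw [lintegral_const_mul' _ _ ENNReal.ofReal_ne_top] at e
    rw [lintegral_lintegral_Ioi hG', e, mass₁, tilt₁]
    exact hpos w
  · have e := lintegral_lintegral_Ioi_neg (((hexp w).comp measurable_fst).mul hG')
    simp only [Function.comp_apply, Pi.mul_apply] at e
    simp_rw [lintegral_const_mul' _ _ ENNReal.ofReal_ne_top] at e
    rw [lintegral_lintegral_Ioi_neg hG', e, mass₂, tilt₂]
    exact hneg w
  · intro x y s t
    refine (le_of_eq ?_).trans ((hFG x (y + t • v) (s - x ⬝ᵥ v) t).trans (le_of_eq ?_))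
    · simp [add_assoc]
    · congr 3
      rw [dotProduct_add, dotProduct_smul, smul_eq_mul]
      ring

/-- Appending a coordinate, as a map `ℝⁿ × ℝ → ℝⁿ⁺¹`. -/
def consProd (p : (Fin n → ℝ) × ℝ) : Fin (n + 1) → ℝ := Fin.cons p.2 p.1

lemma measurePreserving_consProd : MeasurePreserving (consProd (n := n)) := by
  have h := ((volume_preserving_piFinSuccAbove (fun _ : Fin (n + 1) => ℝ) 0).symm).comp
    (Measure.measurePreserving_swap (μ := (volume : Measure (Fin n → ℝ)))
      (ν := (volume : Measure ℝ)))
  rw [← Measure.volume_eq_prod] at h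
  convert h using 1
  ext p i
  simp [consProd, MeasurableEquiv.piFinSuccAbove, Fin.insertNthEquiv]

lemma consProd_dotProduct_consProd (p q : (Fin n → ℝ) × ℝ) :
    consProd p ⬝ᵥ consProd q = p.1 ⬝ᵥ q.1 + p.2 * q.2 := by
  simp [consProd, dotProduct, Fin.sum_univ_succ, add_comm]

lemma iSup_lintegral_indicator_closedBall_min {E : Type*} [NormedAddCommGroup E]
    [MeasurableSpace E] [BorelSpace E] (μ : Measure E) {G : E → ENNReal} (hG : Measurable G) :
    ⨆ k : ℕ, ∫⁻ p, (Metric.closedBall 0 (k : ℝ)).indicator (fun p => min (G p) k) p ∂μ =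
      ∫⁻ p, G p ∂μ := by
  rw [← lintegral_iSup]
  · refine lintegral_congr fun p => le_antisymm (iSup_le fun k => ?_) ?_
    · exact (indicator_le_self' (fun _ _ => zero_le) p).trans (min_le_left _ _)
    · have : G p = ⨆ j : ℕ, min (G p) j := by
        rw [← inf_iSup_eq, ENNReal.iSup_natCast, inf_top_eq]
      refine this.trans_le (iSup_le fun j => le_iSup_of_le (max j ⌈‖p‖⌉₊) ?_)
      rw [indicator_of_mem]
      · exact min_le_min_left _ (by exact_mod_cast le_max_left _ _)
      · rw [mem_closedBall_zero_iff]
        exact (Nat.le_ceil _).trans (by exact_mod_cast le_max_right _ _)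
  · exact fun k => (hG.min measurable_const).indicator measurableSet_closedBall
  · intro i j hij p
    have hij' : (i : ℝ) ≤ j := by exact_mod_cast hij
    refine (indicator_le_indicator_of_subset (Metric.closedBall_subset_closedBall hij')
      (fun _ => zero_le) p).trans (indicator_le_indicator ?_)
    exact min_le_min_left _ (by exact_mod_cast hij)

lemma CenteredSantalo.succ (hn : CenteredSantalo n) : CenteredSantalo (n + 1) := by
  intro F G hF hG hcent hFG
  have hι := measurePreserving_consProd (n := n)
  rw [← hι.lintegral_comp hG, ← iSup_lintegral_indicator_closedBall_min _
    (G := fun p => G (consProd p)) (hG.comp hι.measurable), ENNReal.mul_iSup]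
  refine iSup_le fun k => ?_
  set Gk : (Fin n → ℝ) × ℝ → ENNReal :=
    (Metric.closedBall 0 (k : ℝ)).indicator fun p => min (G (consProd p)) k
  have hGkm : Measurable Gk :=
    ((hG.comp hι.measurable).min measurable_const).indicator measurableSet_closedBall
  have hGki : ∫⁻ p, Gk p ≠ ⊤ := by
    rw [lintegral_indicator measurableSet_closedBall]
    refine (lt_of_le_of_lt (lintegral_mono fun p => min_le_right _ _) ?_).ne
    rw [setLIntegral_const]
    exact ENNReal.mul_lt_top (ENNReal.natCast_lt_top k) measure_closedBall_lt_top
  obtain ⟨z, c, h⟩ := hn.exists_center hGkm hGki k.cast_nonneg fun p hp =>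
    indicator_of_notMem (by simpa using hp) _
  have hexp : Measurable fun x : Fin (n + 1) → ℝ =>
      ENNReal.ofReal (Real.exp (x ⬝ᵥ consProd (z, c))) := by
    have := measurable_dotProduct_const (consProd (z, c))
    fun_prop
  refine le_trans ?_ (h (fun p => ENNReal.ofReal (Real.exp (consProd p ⬝ᵥ consProd (z, c))) *
    F (consProd p)) ((hexp.mul hF).comp hι.measurable) fun x y s t => ?_)
  · gcongr
    exact (hcent (consProd (z, c))).trans_eq (hι.lintegral_comp (hexp.mul hF)).symm
  · have hle : Gk (z + y, c + t) ≤ G (consProd (z + y, c + t)) :=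
      (indicator_le_self' (fun _ _ => zero_le) _).trans (min_le_left _ _)
    calc _ ≤ ENNReal.ofReal (Real.exp (consProd (x, s) ⬝ᵥ consProd (z, c))) *
          (F (consProd (x, s)) * G (consProd (z + y, c + t))) := by
          rw [mul_assoc]; gcongr
      _ ≤ ENNReal.ofReal (Real.exp (consProd (x, s) ⬝ᵥ consProd (z, c))) *
          ENNReal.ofReal (Real.exp (-(consProd (x, s) ⬝ᵥ consProd (z + y, c + t)))) := by
          gcongr; exact hFG _ _
      _ = _ := by
          rw [← ENNReal.ofReal_mul (by positivity), ← Real.exp_add]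
          simp only [consProd_dotProduct_consProd, dotProduct_add]
          congr 2; ring

lemma centeredSantalo (n : ℕ) : CenteredSantalo n := by
  induction n with
  | zero => exact centeredSantalo_zero
  | succ n ih => exact ih.succ

end Induction


/-- The functional Blaschke–Santaló inequality: if `f, g` are Borel measurable,
`x ↦ e^{-f(x)} x` is integrable with vanishing integral, and
`f(x) + g(y) ≥ ⟨x, y⟩` for all `x, y`, then
`(∫ e^{-f})(∫ e^{-g}) ≤ (2π)ⁿ`. -/
theorem functional_blaschke_santalo {n : ℕ} (hn : 1 ≤ n)
    (f g : EuclideanSpace ℝ (Fin n) → ℝ) (hf : Measurable f) (hg : Measurable g)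
    (hint : Integrable (fun x => Real.exp (-f x) • x)
      (volume : Measure (EuclideanSpace ℝ (Fin n))))
    (hcent : ∫ x, Real.exp (-f x) • x ∂(volume : Measure (EuclideanSpace ℝ (Fin n))) = 0)
    (hfg : ∀ x y : EuclideanSpace ℝ (Fin n), f x + g y ≥ ⟪x, y⟫) :
    (∫⁻ x, ENNReal.ofReal (Real.exp (-f x)) ∂(volume : Measure (EuclideanSpace ℝ (Fin n)))) *
      (∫⁻ y, ENNReal.ofReal (Real.exp (-g y)) ∂(volume : Measure (EuclideanSpace ℝ (Fin n)))) ≤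
      ENNReal.ofReal ((2 * Real.pi) ^ n) := by
  have hι := PiLp.volume_preserving_toLp (Fin n)
  have hinner : ∀ x y : Fin n → ℝ,
      ⟪(WithLp.toLp 2 x : EuclideanSpace ℝ (Fin n)), WithLp.toLp 2 y⟫ = x ⬝ᵥ y := fun x y => by
    rw [EuclideanSpace.inner_toLp_toLp, star_trivial, dotProduct_comm]
  set F : EuclideanSpace ℝ (Fin n) → ENNReal := fun x => ENNReal.ofReal (Real.exp (-f x))
  set G : EuclideanSpace ℝ (Fin n) → ENNReal := fun x => ENNReal.ofReal (Real.exp (-g x))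
  have hF : Measurable F := by fun_prop
  have hG : Measurable G := by fun_prop
  rw [← hι.lintegral_comp hF, ← hι.lintegral_comp hG]
  refine centeredSantalo n _ _ (hF.comp hι.measurable) (hG.comp hι.measurable) (fun w => ?_)
    fun x y => ?_
  · set W : EuclideanSpace ℝ (Fin n) := WithLp.toLp 2 w
    have hbdd : ∀ x, Real.exp (-f x) ≤ Real.exp (g 0) := fun x => by
      have := hfg x 0
      rw [inner_zero_right] at this
      gcongr
      linarith
    have hFint : Integrable (fun x => Real.exp (-f x))
        (volume : Measure (EuclideanSpace ℝ (Fin n))) := by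
      refine Integrable.mono' (((integrable_indicator_iff measurableSet_closedBall).2
        (integrableOn_const (C := Real.exp (g 0)) (s := Metric.closedBall 0 1)
          measure_closedBall_lt_top.ne)).add hint.norm) (by fun_prop) (.of_forall fun x => ?_)
      rw [Real.norm_eq_abs, abs_of_pos (Real.exp_pos _), Pi.add_apply]
      by_cases hx : x ∈ Metric.closedBall (0 : EuclideanSpace ℝ (Fin n)) 1
      · rw [Set.indicator_of_mem hx]
        exact (hbdd x).trans (le_add_of_nonneg_right (norm_nonneg _))
      · rw [Set.indicator_of_notMem hx, zero_add, norm_smul, Real.norm_eq_abs,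
          abs_of_pos (Real.exp_pos _)]
        rw [mem_closedBall_zero_iff, not_le] at hx
        exact le_mul_of_one_le_right (Real.exp_pos _).le hx.le
    set ν := (volume : Measure (EuclideanSpace ℝ (Fin n))).withDensity F
    have : IsFiniteMeasure ν := isFiniteMeasure_withDensity_ofReal hFint.2
    have hFtop : ∀ᵐ x ∂(volume : Measure (EuclideanSpace ℝ (Fin n))), F x < ⊤ :=
      .of_forall fun x => ENNReal.ofReal_lt_top
    have hsmul : (fun x => (F x).toReal • ⟪W, x⟫) = fun x => ⟪W, Real.exp (-f x) • x⟫ := by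
      ext x
      rw [ENNReal.toReal_ofReal (Real.exp_pos _).le, inner_smul_right, smul_eq_mul]
    have key := measure_univ_le_lintegral_exp (ν := ν) (l := fun x => ⟪W, x⟫)
      ((integrable_withDensity_iff_integrable_smul' hF hFtop).2 (hsmul ▸ hint.const_inner W))
      (by rw [integral_withDensity_eq_integral_toReal_smul hF hFtop, hsmul,
        integral_inner hint, hcent, inner_zero_right])
    rw [withDensity_apply _ MeasurableSet.univ, setLIntegral_univ,
      lintegral_withDensity_eq_lintegral_mul _ hF (by fun_prop), ← hι.lintegral_comp hF,
      ← hι.lintegral_comp (by fun_prop)] at key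
    refine key.trans_eq (lintegral_congr fun x => ?_)
    rw [Pi.mul_apply, mul_comm, hinner, dotProduct_comm]
  · rw [← ENNReal.ofReal_mul (by positivity), ← Real.exp_add, ← hinner]
    gcongr
    linarith [hfg (WithLp.toLp 2 x) (WithLp.toLp 2 y)]
end
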